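/- Fix an integer ℓ > 2. Let ν be an ℓ-core and let r ≥ 0 and s ≥ 0 be such that ν_1 − ν_2 = ν_2 − ν_3 = ⋯ = ν_r − ν_{r+1} = ℓ−1 with ν_{r+1} − ν_{r+2} ≠ ℓ−1, and ν'_1 − ν'_2 = ⋯ = ν'_s − ν'_{s+1} = ℓ−1 with ν'_{s+1} − ν'_{s+2} ≠ ℓ−1 (ν' the transpose). If ν_{r+1} > s, then for every w ≥ 0 the number of (ℓ,0)-JM partitions with ℓ-core ν and ℓ-weight w equals the number of pairs of partitions (α,β) with length of α at most r+1, length of β at most s+1, and |α| + |β| = w. -/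

import Mathlib

noncomputable section

/-!
Common combinatorial definitions: partitions (English notation, rows indexed from 1),
Young diagrams, hooks, rim hooks, ladders, residues, crystal operators (classical and
ladder versions), locked boxes, regularization classes, dominance order.
-/

structure YPartition where
  part : ℕ → ℕ
  zero_at_zero : part 0 = 0
  antitone : ∀ i j : ℕ, 1 ≤ i → i ≤ j → part j ≤ part i
  eventually_zero : ∃ N : ℕ, ∀ i : ℕ, N ≤ i → part i = 0

namespace YPartition

/-- The set of boxes of the Young diagram of `μ` (row, column), both indices ≥ 1. -/
def cells (μ : YPartition) : Set (ℕ × ℕ) :=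
  {p | 1 ≤ p.1 ∧ 1 ≤ p.2 ∧ p.2 ≤ μ.part p.1}

/-- The length of column `b`: the number of rows containing a box in column `b`. -/
def colLen (μ : YPartition) (b : ℕ) : ℕ :=
  Nat.card {a : ℕ | 1 ≤ a ∧ b ≤ μ.part a}

/-- The arm of box `(a,b)`: boxes strictly to its right in its row. -/
def arm (μ : YPartition) (a b : ℕ) : ℕ := μ.part a - b

/-- The leg of box `(a,b)`: boxes strictly below it in its column. -/
def leg (μ : YPartition) (a b : ℕ) : ℕ := μ.colLen b - a

/-- The hook length of the box `(a,b)`: arm + leg + 1. -/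
def hook (μ : YPartition) (a b : ℕ) : ℕ := (μ.part a - b) + (μ.colLen b - a) + 1

/-- The number of boxes of `μ`. -/
def size (μ : YPartition) : ℕ := μ.cells.ncard

/-- The number of (nonzero) parts of `μ`. -/
def length (μ : YPartition) : ℕ := μ.colLen 1

/-- `μ` is an `(ℓ,0)`-JM partition: there are no boxes `(a,b)`, `(a,y)`, `(x,b)` with
`ℓ ∣ hook (a,b)` while `ℓ` divides neither `hook (a,y)` nor `hook (x,b)`. -/
def IsJM (ℓ : ℕ) (μ : YPartition) : Prop :=
  ¬ ∃ a b y x : ℕ, (a, b) ∈ μ.cells ∧ (a, y) ∈ μ.cells ∧ (x, b) ∈ μ.cells ∧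
    ℓ ∣ μ.hook a b ∧ ¬ ℓ ∣ μ.hook a y ∧ ¬ ℓ ∣ μ.hook x b

/-- Two boxes share an edge. -/
def BoxAdjacent (p q : ℕ × ℕ) : Prop :=
  (p.1 = q.1 ∧ (p.2 + 1 = q.2 ∨ q.2 + 1 = p.2)) ∨
  (p.2 = q.2 ∧ (p.1 + 1 = q.1 ∨ q.1 + 1 = p.1))

/-- A set of boxes is connected (via shared edges, inside the set). -/
def SetConnected (S : Set (ℕ × ℕ)) : Prop :=
  ∀ p ∈ S, ∀ q ∈ S,
    Relation.ReflTransGen (fun x y => x ∈ S ∧ y ∈ S ∧ BoxAdjacent x y) p q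

/-- `S` contains no 2 × 2 square of boxes. -/
def HasNoSquare (S : Set (ℕ × ℕ)) : Prop :=
  ¬ ∃ a b : ℕ, (a, b) ∈ S ∧ (a + 1, b) ∈ S ∧ (a, b + 1) ∈ S ∧ (a + 1, b + 1) ∈ S

/-- `S` is a removable `ℓ`-rim hook of `μ`: a connected set of `ℓ` boxes of `μ` with no
2 × 2 square whose removal leaves the Young diagram of a partition. -/
def IsRimHook (ℓ : ℕ) (μ : YPartition) (S : Set (ℕ × ℕ)) : Prop :=
  S ⊆ μ.cells ∧ S.ncard = ℓ ∧ SetConnected S ∧ HasNoSquare S ∧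
    ∃ ν : YPartition, ν.cells = μ.cells \ S

/-- `S` is contained in a single row. -/
def HorizontalHook (S : Set (ℕ × ℕ)) : Prop := ∃ a : ℕ, ∀ p ∈ S, p.1 = a

/-- `S` is contained in a single column. -/
def VerticalHook (S : Set (ℕ × ℕ)) : Prop := ∃ b : ℕ, ∀ p ∈ S, p.2 = b

/-- Two sets of boxes are adjacent when some box of one shares an edge with a box of the other. -/
def SetsAdjacent (R S : Set (ℕ × ℕ)) : Prop := ∃ p ∈ R, ∃ q ∈ S, BoxAdjacent p q

/-- An `ℓ`-core: a partition with no removable `ℓ`-rim hook. -/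
def IsCore (ℓ : ℕ) (μ : YPartition) : Prop := ¬ ∃ S : Set (ℕ × ℕ), IsRimHook ℓ μ S

/-- `p` and `q` lie on the same ladder: going down one column step the row increases
by `ℓ - 1`. -/
def SameLadder (ℓ : ℕ) (p q : ℕ × ℕ) : Prop :=
  (q.1 : ℤ) - (p.1 : ℤ) = ((ℓ : ℤ) - 1) * ((p.2 : ℤ) - (q.2 : ℤ))

/-- The index of the ladder through `p`: the ladder through `(k,1)` has index `k`. -/
def ladderIdx (ℓ : ℕ) (p : ℕ × ℕ) : ℕ := p.1 + (ℓ - 1) * (p.2 - 1)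

/-- The residue of position `(a,b)` is `b - a` mod `ℓ`. -/
def res (ℓ : ℕ) (p : ℕ × ℕ) : ℕ := (((p.2 : ℤ) - (p.1 : ℤ)) % (ℓ : ℤ)).toNat

/-- `p` is a removable box of `μ`. -/
def Removable (μ : YPartition) (p : ℕ × ℕ) : Prop :=
  1 ≤ p.1 ∧ p.2 = μ.part p.1 ∧ μ.part (p.1 + 1) < p.2

/-- `p` is an addable box of `μ`. -/
def Addable (μ : YPartition) (p : ℕ × ℕ) : Prop :=
  1 ≤ p.1 ∧ p.2 = μ.part p.1 + 1 ∧ (p.1 = 1 ∨ p.2 ≤ μ.part (p.1 - 1))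

/-- The removable `i`-boxes of `μ`. -/
def RemovableRes (ℓ i : ℕ) (μ : YPartition) : Set (ℕ × ℕ) :=
  {p | Removable μ p ∧ res ℓ p = i}

/-- The addable `i`-boxes of `μ`. -/
def AddableRes (ℓ i : ℕ) (μ : YPartition) : Set (ℕ × ℕ) :=
  {p | Addable μ p ∧ res ℓ p = i}

/-- Ladder reading order (reflexive): ladders left to right, top to bottom within a ladder.
`LadderLE ℓ p q` means `p` is read before (or equal to) `q`. -/
def LadderLE (ℓ : ℕ) (p q : ℕ × ℕ) : Prop :=
  ladderIdx ℓ p < ladderIdx ℓ q ∨ (ladderIdx ℓ p = ladderIdx ℓ q ∧ p.1 ≤ q.1)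

/-- Strict ladder reading order. -/
def LadderLT (ℓ : ℕ) (p q : ℕ × ℕ) : Prop :=
  ladderIdx ℓ p < ladderIdx ℓ q ∨ (ladderIdx ℓ p = ladderIdx ℓ q ∧ p.1 < q.1)

/-- Classical reading order (reflexive): rows from bottom to top.
`RowLE p q` means `p` is read before (or equal to) `q`. -/
def RowLE (p q : ℕ × ℕ) : Prop := q.1 ≤ p.1

/-- Given a reading order `le`, a set `Rem` of `-` marks and `Add` of `+` marks, a `-` at `p`
survives the cancellation of adjacent `-+` pairs iff every interval of the reading word
starting at `p` contains strictly more `-`'s than `+`'s. -/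
def NormalIn (le : ℕ × ℕ → ℕ × ℕ → Prop) (Rem Add : Set (ℕ × ℕ)) (p : ℕ × ℕ) : Prop :=
  p ∈ Rem ∧ ∀ q ∈ Rem ∪ Add, le p q →
    (Add ∩ {s | le p s ∧ le s q}).ncard < (Rem ∩ {s | le p s ∧ le s q}).ncard

/-- A `+` at `q` survives the cancellation of adjacent `-+` pairs iff every interval of the
reading word ending at `q` contains strictly more `+`'s than `-`'s. -/
def ConormalIn (le : ℕ × ℕ → ℕ × ℕ → Prop) (Rem Add : Set (ℕ × ℕ)) (q : ℕ × ℕ) : Prop :=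
  q ∈ Add ∧ ∀ p ∈ Rem ∪ Add, le p q →
    (Rem ∩ {s | le p s ∧ le s q}).ncard < (Add ∩ {s | le p s ∧ le s q}).ncard

/-- Ladder normal `i`-box. -/
def LadderNormal (ℓ i : ℕ) (μ : YPartition) (p : ℕ × ℕ) : Prop :=
  NormalIn (LadderLE ℓ) (RemovableRes ℓ i μ) (AddableRes ℓ i μ) p

/-- Ladder conormal `i`-box. -/
def LadderConormal (ℓ i : ℕ) (μ : YPartition) (p : ℕ × ℕ) : Prop :=
  ConormalIn (LadderLE ℓ) (RemovableRes ℓ i μ) (AddableRes ℓ i μ) p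

/-- Normal `i`-box (classical signature). -/
def ClassNormal (ℓ i : ℕ) (μ : YPartition) (p : ℕ × ℕ) : Prop :=
  NormalIn RowLE (RemovableRes ℓ i μ) (AddableRes ℓ i μ) p

/-- Conormal `i`-box (classical signature). -/
def ClassConormal (ℓ i : ℕ) (μ : YPartition) (p : ℕ × ℕ) : Prop :=
  ConormalIn RowLE (RemovableRes ℓ i μ) (AddableRes ℓ i μ) p

/-- `ε̂_i(μ)`: number of ladder normal `i`-boxes. -/
def hatEps (ℓ i : ℕ) (μ : YPartition) : ℕ := {p | LadderNormal ℓ i μ p}.ncard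

/-- `φ̂_i(μ)`: number of ladder conormal `i`-boxes. -/
def hatPhi (ℓ i : ℕ) (μ : YPartition) : ℕ := {p | LadderConormal ℓ i μ p}.ncard

/-- `ε_i(μ)`: number of normal `i`-boxes. -/
def eps (ℓ i : ℕ) (μ : YPartition) : ℕ := {p | ClassNormal ℓ i μ p}.ncard

/-- `φ_i(μ)`: number of conormal `i`-boxes. -/
def phi (ℓ i : ℕ) (μ : YPartition) : ℕ := {p | ClassConormal ℓ i μ p}.ncard

/-- The ladder good `i`-box: the leftmost `-` of the reduced ladder `i`-signature. -/
def LadderGood (ℓ i : ℕ) (μ : YPartition) (p : ℕ × ℕ) : Prop :=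
  LadderNormal ℓ i μ p ∧ ∀ q, LadderNormal ℓ i μ q → LadderLE ℓ p q

/-- The ladder cogood `i`-box: the rightmost `+` of the reduced ladder `i`-signature. -/
def LadderCogood (ℓ i : ℕ) (μ : YPartition) (p : ℕ × ℕ) : Prop :=
  LadderConormal ℓ i μ p ∧ ∀ q, LadderConormal ℓ i μ q → LadderLE ℓ q p

/-- The good `i`-box (classical). -/
def ClassGood (ℓ i : ℕ) (μ : YPartition) (p : ℕ × ℕ) : Prop :=
  ClassNormal ℓ i μ p ∧ ∀ q, ClassNormal ℓ i μ q → RowLE p q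

/-- The cogood `i`-box (classical). -/
def ClassCogood (ℓ i : ℕ) (μ : YPartition) (p : ℕ × ℕ) : Prop :=
  ClassConormal ℓ i μ p ∧ ∀ q, ClassConormal ℓ i μ q → RowLE q p

/-- The ladder crystal operator `f̂_i` as a relation: `mu = f̂_i lam ≠ 0`. -/
def HatF (ℓ i : ℕ) (lam mu : YPartition) : Prop :=
  ∃ p, LadderCogood ℓ i lam p ∧ mu.cells = insert p lam.cells

/-- The ladder crystal operator `ê_i` as a relation: `mu = ê_i lam ≠ 0`. -/
def HatE (ℓ i : ℕ) (lam mu : YPartition) : Prop :=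
  ∃ p, LadderGood ℓ i lam p ∧ mu.cells = lam.cells \ {p}

/-- The classical crystal operator `f̃_i` as a relation: `mu = f̃_i lam ≠ 0`. -/
def TildeF (ℓ i : ℕ) (lam mu : YPartition) : Prop :=
  ∃ p, ClassCogood ℓ i lam p ∧ mu.cells = insert p lam.cells

/-- The classical crystal operator `ẽ_i` as a relation: `mu = ẽ_i lam ≠ 0`. -/
def TildeE (ℓ i : ℕ) (lam mu : YPartition) : Prop :=
  ∃ p, ClassGood ℓ i lam p ∧ mu.cells = lam.cells \ {p}

/-- `n`-fold composition of a relation. -/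
def RelIter {α : Type} (r : α → α → Prop) : ℕ → α → α → Prop
  | 0 => fun a b => a = b
  | n + 1 => fun a b => ∃ c, r a c ∧ RelIter r n c b

/-- The empty partition. -/
def emptyP : YPartition where
  part := fun _ => 0
  zero_at_zero := rfl
  antitone := fun _ _ _ _ => le_rfl
  eventually_zero := ⟨0, fun _ _ => rfl⟩

/-- `μ` is a node of the ladder crystal `B(Λ₀)^L`: it is obtained from the empty
partition by finitely many applications of the operators `f̂_i`, `0 ≤ i < ℓ`. -/
def LadderNode (ℓ : ℕ) (μ : YPartition) : Prop :=
  Relation.ReflTransGen (fun a b => ∃ i : ℕ, i < ℓ ∧ HatF ℓ i a b) emptyP μ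

/-- The type I locking condition at `(a,b)`: every unoccupied position on the ladder of
`(a,b)` lying below it has an unoccupied position directly above it. -/
def LadderClear (ℓ : ℕ) (μ : YPartition) (a b : ℕ) : Prop :=
  ∀ c d : ℕ, 1 ≤ c → 1 ≤ d → SameLadder ℓ (a, b) (c, d) → a < c →
    (c, d) ∉ μ.cells → (c - 1, d) ∉ μ.cells

/-- Locked boxes of `μ`. -/
inductive Locked (ℓ : ℕ) (μ : YPartition) : ℕ × ℕ → Prop where
  | typeI_top : ∀ b : ℕ, (1, b) ∈ μ.cells → LadderClear ℓ μ 1 b → Locked ℓ μ (1, b)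
  | typeI_up : ∀ a b : ℕ, (a + 1, b) ∈ μ.cells → Locked ℓ μ (a, b) →
      LadderClear ℓ μ (a + 1) b → Locked ℓ μ (a + 1, b)
  | typeII : ∀ a b b' : ℕ, (a, b) ∈ μ.cells → b < b' → Locked ℓ μ (a, b') → Locked ℓ μ (a, b)

/-- Number of boxes of `μ` on the `k`-th ladder. -/
def ladderCount (ℓ : ℕ) (μ : YPartition) (k : ℕ) : ℕ :=
  (μ.cells ∩ {p | ladderIdx ℓ p = k}).ncard

/-- `lam` and `mu` lie in the same regularization class: they have the same number of
boxes on every ladder. -/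
def SameRegClass (ℓ : ℕ) (lam mu : YPartition) : Prop :=
  ∀ k : ℕ, ladderCount ℓ lam k = ladderCount ℓ mu k

/-- The boxes of `μ` are top-justified on each ladder. -/
def TopJustified (ℓ : ℕ) (μ : YPartition) : Prop :=
  ∀ p ∈ μ.cells, ∀ q : ℕ × ℕ, 1 ≤ q.1 → 1 ≤ q.2 →
    ladderIdx ℓ q = ladderIdx ℓ p → q.1 < p.1 → q ∈ μ.cells

/-- `mu = R lam`: the regularization of `lam`, obtained by moving every box of `lam` to
the topmost unoccupied positions of its ladder. -/
def IsRegularization (ℓ : ℕ) (lam mu : YPartition) : Prop :=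
  SameRegClass ℓ lam mu ∧ TopJustified ℓ mu

/-- Dominance order on partitions. -/
def DomLE (lam mu : YPartition) : Prop :=
  ∀ j : ℕ, ∑ i ∈ Finset.Icc 1 j, lam.part i ≤ ∑ i ∈ Finset.Icc 1 j, mu.part i

/-- All (positive) positions on the `k`-th ladder. -/
def LadderPositions (ℓ k : ℕ) : Set (ℕ × ℕ) :=
  {p | 1 ≤ p.1 ∧ 1 ≤ p.2 ∧ ladderIdx ℓ p = k}

/-- The set of locked boxes of `μ`. -/
def lockedCells (ℓ : ℕ) (μ : YPartition) : Set (ℕ × ℕ) := {p | Locked ℓ μ p}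

/-- The number of unlocked boxes of `μ` on the `k`-th ladder. -/
def unlockedCount (ℓ : ℕ) (μ : YPartition) (k : ℕ) : ℕ :=
  ((μ.cells ∩ LadderPositions ℓ k) \ lockedCells ℓ μ).ncard

/-- The diagram `S μ`: locked boxes stay put, and on each ladder the unlocked boxes are
moved into the lowest positions of that ladder not occupied by locked boxes. -/
def SCells (ℓ : ℕ) (μ : YPartition) : Set (ℕ × ℕ) :=
  lockedCells ℓ μ ∪
    {p | 1 ≤ p.1 ∧ 1 ≤ p.2 ∧ p ∉ lockedCells ℓ μ ∧
      ((LadderPositions ℓ (ladderIdx ℓ p) ∩ {q | p.1 < q.1}) \ lockedCells ℓ μ).ncard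
        < unlockedCount ℓ μ (ladderIdx ℓ p)}

/-- `μ` is `ℓ`-regular: no part occurs `ℓ` or more times. -/
def IsRegular (ℓ : ℕ) (μ : YPartition) : Prop :=
  ∀ a : ℕ, 1 ≤ a → 0 < μ.part (a + (ℓ - 1)) → μ.part (a + (ℓ - 1)) < μ.part a

/-- Removal of a single horizontal or vertical `ℓ`-rim hook. -/
def RemoveHV (ℓ : ℕ) (lam mu : YPartition) : Prop :=
  ∃ S : Set (ℕ × ℕ), IsRimHook ℓ lam S ∧ (HorizontalHook S ∨ VerticalHook S) ∧
    mu.cells = lam.cells \ S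

/-- Condition (1): every removable `ℓ`-rim hook is horizontal or vertical. -/
def Cond1 (ℓ : ℕ) (μ : YPartition) : Prop :=
  ∀ S : Set (ℕ × ℕ), IsRimHook ℓ μ S → HorizontalHook S ∨ VerticalHook S

/-- Condition (2): no vertical (resp. horizontal) `ℓ`-rim hook `R` of `μ` together with an
adjacent horizontal (resp. vertical) `ℓ`-rim hook `S` of `μ \ R` . -/
def Cond2 (ℓ : ℕ) (μ : YPartition) : Prop :=
  ¬ ∃ (R S : Set (ℕ × ℕ)) (ν : YPartition), IsRimHook ℓ μ R ∧ ν.cells = μ.cells \ R ∧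
    IsRimHook ℓ ν S ∧ SetsAdjacent R S ∧
    ((VerticalHook R ∧ HorizontalHook S) ∨ (HorizontalHook R ∧ VerticalHook S))

/-- A generalized `ℓ`-partition: conditions (1) and (2) hold after removing any sequence of
horizontal and vertical `ℓ`-rim hooks (including the empty sequence). -/
def IsGenLPartition (ℓ : ℕ) (lam : YPartition) : Prop :=
  ∀ mu : YPartition, Relation.ReflTransGen (RemoveHV ℓ) lam mu → Cond1 ℓ mu ∧ Cond2 ℓ mu

/-- The `t`-th row (from the top) of the bottom block of the decomposition
`(μ, r, s, ρ, σ)`: the number of values `v ∈ [1, s+1]` whose column block still reaches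
row `t`; column block `v` consists of `σ_v·ℓ + (s+1−v)(ℓ−1)` rows of length `≥ v`. -/
def bottomPart (ℓ s : ℕ) (σ : YPartition) (t : ℕ) : ℕ :=
  ((Finset.Icc 1 (s + 1)).filter fun v => t ≤ σ.part v * ℓ + (s + 1 - v) * (ℓ - 1)).card

/-- The `i`-th part of the partition corresponding to the data `(μ, r, s, ρ, σ)`. -/
def decompPart (ℓ : ℕ) (mu : YPartition) (r s : ℕ) (ρ σ : YPartition) (i : ℕ) : ℕ :=
  if i = 0 then 0
  else if i ≤ r + 1 then s + mu.part 1 + (r + 1 - i) * (ℓ - 1) + ρ.part i * ℓ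
  else if i ≤ r + max mu.length 1 then s + mu.part (i - r)
  else bottomPart ℓ s σ (i - (r + max mu.length 1))

/-- Admissibility of the decomposition data `(μ, r, s, ρ, σ)`. -/
def GoodData (ℓ : ℕ) (mu : YPartition) (r s : ℕ) (ρ σ : YPartition) : Prop :=
  IsCore ℓ mu ∧ mu.part 1 < mu.part 2 + (ℓ - 1) ∧ mu.colLen 1 < mu.colLen 2 + (ℓ - 1) ∧
  ρ.length ≤ r + 1 ∧ σ.length ≤ s + 1 ∧
  (mu.cells = ∅ → ρ.part (r + 1) = 0 ∨ σ.part (s + 1) = 0)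

/-- `lam ≈ (μ, r, s, ρ, σ)`. -/
def Decomposes (ℓ : ℕ) (lam mu : YPartition) (r s : ℕ) (ρ σ : YPartition) : Prop :=
  ∀ i : ℕ, lam.part i = decompPart ℓ mu r s ρ σ i

/-- Removal of a single `ℓ`-rim hook. -/
def RemoveHook (ℓ : ℕ) (lam mu : YPartition) : Prop :=
  ∃ S : Set (ℕ × ℕ), IsRimHook ℓ lam S ∧ mu.cells = lam.cells \ S

/-- `lam` has `ℓ`-core `nu` and `ℓ`-weight `w`. -/
def HasCoreAndWeight (ℓ : ℕ) (lam nu : YPartition) (w : ℕ) : Prop :=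
  IsCore ℓ nu ∧ RelIter (RemoveHook ℓ) w lam nu

/-- An L-partition. -/
def IsLPartition (ℓ : ℕ) (lam : YPartition) : Prop :=
  ¬ ∃ p : ℕ × ℕ, p ∈ lam.cells ∧ ℓ ∣ lam.hook p.1 p.2 ∧
    (lam.arm p.1 p.2 < (ℓ - 1) * lam.leg p.1 p.2 ∨
     lam.leg p.1 p.2 < (ℓ - 1) * lam.arm p.1 p.2)

end YPartition

open YPartition

theorem YPartition.ext_part {l m : YPartition} (h : ∀ i, 1 ≤ i → l.part i = m.part i) : l = m := by
  have h2 : l.part = m.part := by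
    funext i
    rcases Nat.eq_zero_or_pos i with rfl | hi
    · rw [l.zero_at_zero, m.zero_at_zero]
    · exact h i hi
  cases l; cases m; cases h2; rfl

/-- Build a partition from a weakly decreasing function. -/
theorem exists_part (f : ℕ → ℕ) (h0 : f 0 = 0) (h1 : ∀ i, 1 ≤ i → f (i + 1) ≤ f i)
    (h2 : ∃ N : ℕ, ∀ i, N ≤ i → f i = 0) : ∃ m : YPartition, ∀ i, m.part i = f i := by
  refine ⟨⟨f, h0, ?_, h2⟩, fun i => rfl⟩
  intro i j hi hij
  induction j, hij using Nat.le_induction with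
  | base => exact le_rfl
  | succ k hk ih => exact (h1 k (hi.trans hk)).trans ih

/-- The set of bead positions of a partition. -/
def beads (m : YPartition) : Set ℤ := {z | ∃ i : ℕ, 1 ≤ i ∧ z = (m.part i : ℤ) - i}

theorem bead_strict (m : YPartition) {i j : ℕ} (hi : 1 ≤ i) (hij : i < j) :
    (m.part j : ℤ) - j < (m.part i : ℤ) - i := by
  have := m.antitone i j hi hij.le
  omega

theorem bead_le (m : YPartition) {i j : ℕ} (hi : 1 ≤ i) (hij : i ≤ j) :
    (m.part j : ℤ) - j ≤ (m.part i : ℤ) - i := by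
  have := m.antitone i j hi hij
  omega

theorem bead_lt_iff (m : YPartition) {i j : ℕ} (hi : 1 ≤ i) (hj : 1 ≤ j) :
    (m.part j : ℤ) - j < (m.part i : ℤ) - i ↔ i < j := by
  constructor
  · intro h
    by_contra hc
    have := bead_le m hj (not_lt.mp hc)
    omega
  · exact bead_strict m hi

theorem bead_inj (m : YPartition) {i j : ℕ} (hi : 1 ≤ i) (hj : 1 ≤ j)
    (h : (m.part i : ℤ) - i = (m.part j : ℤ) - j) : i = j := by
  rcases lt_trichotomy i j with h1 | h1 | h1
  · have := bead_strict m hi h1; omega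
  · exact h1
  · have := bead_strict m hj h1; omega

theorem beads_inj_aux {l m : YPartition} (h : beads l = beads m) :
    ∀ n : ℕ, (∀ i, 1 ≤ i → i < n → l.part i = m.part i) → 1 ≤ n → l.part n ≤ m.part n := by
  intro n hn h1
  have hb : (l.part n : ℤ) - n ∈ beads m := by
    rw [← h]; exact ⟨n, h1, rfl⟩
  obtain ⟨k, hk, he⟩ := hb
  by_cases hkn : k < n
  · have := hn k hk hkn
    have := bead_strict l hk hkn
    omega
  · have := bead_le m h1 (not_lt.mp hkn)
    omega

theorem beads_inj {l m : YPartition} (h : beads l = beads m) : l = m := by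
  apply YPartition.ext_part
  intro n
  induction n using Nat.strong_induction_on with
  | _ n ih =>
    intro hn
    apply le_antisymm
    · exact beads_inj_aux h n (fun i hi hin => ih i hin hi) hn
    · exact beads_inj_aux h.symm n (fun i hi hin => (ih i hin hi).symm) hn

theorem exists_col (m : YPartition) (b : ℕ) (hb : 1 ≤ b) :
    ∃ k : ℕ, ∀ a, 1 ≤ a → (b ≤ m.part a ↔ a ≤ k) := by
  obtain ⟨N, hN⟩ := m.eventually_zero
  have hex : ∃ k : ℕ, m.part (k + 1) < b := ⟨N, by rw [hN _ (by omega)]; omega⟩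
  classical
  refine ⟨Nat.find hex, fun a ha => ⟨fun h => ?_, fun h => ?_⟩⟩
  · by_contra hc
    have h1 := Nat.find_spec hex
    have h2 := m.antitone (Nat.find hex + 1) a (by omega) (by omega)
    omega
  · have h1 := Nat.find_min hex (m := a - 1) (by omega)
    rw [Nat.sub_add_cancel ha] at h1
    omega

theorem colLen_iff (m : YPartition) {a b : ℕ} (ha : 1 ≤ a) (hb : 1 ≤ b) :
    b ≤ m.part a ↔ a ≤ m.colLen b := by
  obtain ⟨k, hk⟩ := exists_col m b hb
  have : m.colLen b = k := by
    unfold YPartition.colLen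
    have hs : {a : ℕ | 1 ≤ a ∧ b ≤ m.part a} = ((Finset.Icc 1 k : Finset ℕ) : Set ℕ) := by
      ext x
      simp only [Set.mem_ofPred_eq, Finset.coe_Icc, Set.mem_Icc]
      constructor
      · rintro ⟨h1, h2⟩; exact ⟨h1, (hk x h1).1 h2⟩
      · rintro ⟨h1, h2⟩; exact ⟨h1, (hk x h1).2 h2⟩
    rw [hs]
    simp
  rw [this]
  exact hk a ha

/-- position of the `b`-th gap. -/
def gapPos (m : YPartition) (b : ℕ) : ℤ := (b : ℤ) - 1 - m.colLen b

theorem gap_lt_iff (m : YPartition) {a b : ℕ} (ha : 1 ≤ a) (hb : 1 ≤ b) :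
    gapPos m b < (m.part a : ℤ) - a ↔ b ≤ m.part a := by
  have := colLen_iff m ha hb
  unfold gapPos
  constructor
  · intro h
    by_contra hc
    have : ¬ a ≤ m.colLen b := fun h => hc (this.2 h)
    omega
  · intro h
    have := this.1 h
    omega

theorem gapPos_not_bead (m : YPartition) {b : ℕ} (hb : 1 ≤ b) : gapPos m b ∉ beads m := by
  rintro ⟨a, ha, h⟩
  have := colLen_iff m ha hb
  unfold gapPos at h
  by_cases hc : b ≤ m.part a
  · have := this.1 hc; omega
  · have : ¬ a ≤ m.colLen b := fun h => hc (this.2 h)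
    omega

theorem exists_gap (m : YPartition) {z : ℤ} (hz : z ∉ beads m) :
    ∃ b : ℕ, 1 ≤ b ∧ z = gapPos m b := by
  obtain ⟨N, hN⟩ := m.eventually_zero
  have hex : ∃ k : ℕ, (m.part (k + 1) : ℤ) - (k + 1 : ℕ) < z := by
    refine ⟨N + z.natAbs, ?_⟩
    rw [hN _ (by omega)]; omega
  classical
  obtain ⟨k, hk1, hk2⟩ : ∃ k : ℕ, (m.part (k + 1) : ℤ) - (k + 1 : ℕ) < z ∧
      ∀ i, 1 ≤ i → i ≤ k → z < (m.part i : ℤ) - i := by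
    refine ⟨Nat.find hex, Nat.find_spec hex, fun i h1 h2 => ?_⟩
    have h3 := Nat.find_min hex (m := i - 1) (by omega)
    rw [Nat.sub_add_cancel h1] at h3
    have : z ≠ (m.part i : ℤ) - i := fun h => hz ⟨i, h1, h⟩
    omega
  push_cast at hk1
  have hb : 1 ≤ (z + 1 + k).toNat := by omega
  refine ⟨(z + 1 + k).toNat, hb, ?_⟩
  have h1 : ¬ (k + 1) ≤ m.colLen (z + 1 + k).toNat := by
    rw [← colLen_iff m (by omega) hb]
    omega
  have h2 : k ≤ m.colLen (z + 1 + k).toNat := by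
    rcases Nat.eq_zero_or_pos k with h | h
    · omega
    · rw [← colLen_iff m h hb]
      have := hk2 k h le_rfl
      omega
  unfold gapPos
  omega

theorem gap_strict (m : YPartition) {i j : ℕ} (hi : 1 ≤ i) (hij : i < j) :
    gapPos m i < gapPos m j := by
  have : m.colLen j ≤ m.colLen i := by
    rcases Nat.eq_zero_or_pos (m.colLen j) with h | h
    · omega
    · have h1 := (colLen_iff m h (by omega : 1 ≤ j)).2 le_rfl
      exact (colLen_iff m h hi).1 (by omega)
  unfold gapPos; omega

theorem gap_le (m : YPartition) {i j : ℕ} (hi : 1 ≤ i) (hij : i ≤ j) :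
    gapPos m i ≤ gapPos m j := by
  rcases hij.eq_or_lt with rfl | h
  · exact le_rfl
  · exact (gap_strict m hi h).le

theorem hook_eq (m : YPartition) {a b : ℕ} (ha : 1 ≤ a) (hb : 1 ≤ b) (h : b ≤ m.part a) :
    (m.hook a b : ℤ) = (m.part a : ℤ) - a - gapPos m b := by
  have := (colLen_iff m ha hb).1 h
  unfold YPartition.hook gapPos
  omega

theorem length_le_iff (m : YPartition) (k : ℕ) : m.length ≤ k ↔ m.part (k + 1) = 0 := by
  have := colLen_iff m (a := k + 1) (b := 1) (by omega) le_rfl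
  unfold YPartition.length
  omega

theorem cells_finite (m : YPartition) : m.cells.Finite := by
  obtain ⟨N, hN⟩ := m.eventually_zero
  apply Set.Finite.subset ((Set.finite_Iic N).prod (Set.finite_Iic (m.part 1)))
  rintro ⟨a, b⟩ ⟨h1, h2, h3⟩
  simp only at h1 h2 h3
  simp only [Set.mem_prod, Set.mem_Iic]
  constructor
  · by_contra hc
    have := hN a (by omega); omega
  · exact h3.trans (m.antitone 1 a le_rfl h1)

theorem isJM_iff (l : ℕ) (m : YPartition) : YPartition.IsJM l m ↔
    ∀ x ∈ beads m, ∀ y, y ∉ beads m → y < x → (l : ℤ) ∣ x - y →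
      (∀ y', y' ∉ beads m → y' < x → (l : ℤ) ∣ x - y') ∨
      (∀ x' ∈ beads m, y < x' → (l : ℤ) ∣ x' - y) := by
  have key : ∀ a b, 1 ≤ a → 1 ≤ b → b ≤ m.part a →
      (l ∣ m.hook a b ↔ (l : ℤ) ∣ (m.part a : ℤ) - a - gapPos m b) := by
    intro a b ha hb h
    rw [← hook_eq m ha hb h, Int.natCast_dvd_natCast]
  constructor
  · rintro h x ⟨a, ha, rfl⟩ y hy hyx hd
    obtain ⟨b, hb, rfl⟩ := exists_gap m hy
    by_contra hc
    push Not at hc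
    obtain ⟨⟨y', hy', hyx', hd'⟩, ⟨x', ⟨a', ha', rfl⟩, hyx2, hd2⟩⟩ := hc
    obtain ⟨b', hb', rfl⟩ := exists_gap m hy'
    rw [gap_lt_iff m ha hb] at hyx
    rw [gap_lt_iff m ha hb'] at hyx'
    rw [gap_lt_iff m ha' hb] at hyx2
    refine h ⟨a, b, b', a', ⟨ha, hb, hyx⟩, ⟨ha, hb', hyx'⟩, ⟨ha', hb, hyx2⟩, ?_, ?_, ?_⟩
    · rwa [key a b ha hb hyx]
    · rwa [key a b' ha hb' hyx']
    · rwa [key a' b ha' hb hyx2]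
  · rintro h ⟨a, b, y, x, ⟨ha, hb, hab⟩, ⟨-, hy, hay⟩, ⟨hx, -, hxb⟩, h1, h2, h3⟩
    simp only at ha hb hab hy hay hx hxb
    rw [key a b ha hb hab] at h1
    rw [key a y ha hy hay] at h2
    rw [key x b hx hb hxb] at h3
    rcases h _ ⟨a, ha, rfl⟩ _ (gapPos_not_bead m hb) ((gap_lt_iff m ha hb).2 hab) h1 with h4 | h4
    · exact h2 (h4 _ (gapPos_not_bead m hy) ((gap_lt_iff m ha hy).2 hay))
    · exact h3 (h4 _ ⟨x, hx, rfl⟩ ((gap_lt_iff m hx hb).2 hxb))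


/-- `m` is obtained from `l` by removing the rim strip in rows `a..b`. -/
structure Strip (l m : YPartition) (a b : ℕ) : Prop where
  ha : 1 ≤ a
  hab : a ≤ b
  out : ∀ i, i < a ∨ b < i → l.part i = m.part i
  mid : ∀ i, a ≤ i → i < b → m.part i + 1 = l.part (i + 1)
  last : m.part b < l.part b

theorem Strip.lt {l m : YPartition} {a b : ℕ} (h : Strip l m a b) {i : ℕ} (h1 : a ≤ i)
    (h2 : i ≤ b) : m.part i < l.part i := by
  rcases h2.eq_or_lt with rfl | h3
  · exact h.last
  · have := h.mid i h1 h3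
    have := l.antitone i (i + 1) (h.ha.trans h1) (by omega)
    omega

theorem Strip.le {l m : YPartition} {a b : ℕ} (h : Strip l m a b) (i : ℕ) :
    m.part i ≤ l.part i := by
  by_cases h1 : a ≤ i
  · by_cases h2 : i ≤ b
    · exact (h.lt h1 h2).le
    · exact (h.out i (by omega)).ge
  · exact (h.out i (by omega)).ge

/-- The cells of the strip. -/
def stripCells (l m : YPartition) : Set (ℕ × ℕ) := l.cells \ m.cells

theorem Strip.mem_iff {l m : YPartition} {a b : ℕ} (h : Strip l m a b) (i j : ℕ) :
    (i, j) ∈ stripCells l m ↔ a ≤ i ∧ i ≤ b ∧ m.part i < j ∧ j ≤ l.part i := by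
  have ha := h.ha
  unfold stripCells YPartition.cells
  simp only [Set.mem_sdiff, Set.mem_ofPred_eq]
  constructor
  · rintro ⟨⟨h1, h2, h3⟩, h4⟩
    have h5 : m.part i < j := by
      by_contra hc
      exact h4 ⟨h1, h2, by omega⟩
    have h6 : ¬ (i < a ∨ b < i) := fun h6 => by have := h.out i h6; omega
    omega
  · rintro ⟨h1, h2, h3, h4⟩
    exact ⟨⟨by omega, by omega, h4⟩, fun h5 => by omega⟩

theorem Strip.step {l m : YPartition} {a b : ℕ} (h : Strip l m a b) {i j : ℕ}
    (hp : (i, j) ∈ stripCells l m) (hne : (i, j) ≠ (b, m.part b + 1)) :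
    ∃ i' j', (i', j') ∈ stripCells l m ∧ YPartition.BoxAdjacent (i, j) (i', j') ∧
      (j' : ℤ) - i' = j - i - 1 := by
  rw [h.mem_iff] at hp
  obtain ⟨h1, h2, h3, h4⟩ := hp
  by_cases hc : m.part i + 1 = j
  · have hib : i ≠ b := by
      rintro rfl
      exact hne (by rw [hc])
    have hm := h.mid i h1 (by omega)
    refine ⟨i + 1, j, ?_, ?_, by push_cast; ring⟩
    · rw [h.mem_iff]
      have := h.lt (i := i + 1) (by omega) (by omega)
      omega
    · right; simp
  · refine ⟨i, j - 1, ?_, ?_, by omega⟩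
    · rw [h.mem_iff]; omega
    · left; simp only [true_and]; omega

theorem Strip.content {l m : YPartition} {a b : ℕ} (h : Strip l m a b) {i j : ℕ}
    (hp : (i, j) ∈ stripCells l m) :
    (m.part b : ℤ) - b < (j : ℤ) - i ∧ (j : ℤ) - i ≤ (l.part a : ℤ) - a := by
  rw [h.mem_iff] at hp
  obtain ⟨h1, h2, h3, h4⟩ := hp
  have := bead_le l h.ha h1
  have := bead_le m (h.ha.trans h1) h2
  omega

theorem Strip.inj {l m : YPartition} {a b : ℕ} (h : Strip l m a b) {i j i' j' : ℕ}
    (hp : (i, j) ∈ stripCells l m) (hq : (i', j') ∈ stripCells l m)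
    (he : (j : ℤ) - i = (j' : ℤ) - i') : ¬ i < i' := by
  rw [h.mem_iff] at hp hq
  obtain ⟨h1, h2, h3, h4⟩ := hp
  obtain ⟨h1', h2', h3', h4'⟩ := hq
  intro hlt
  have := h.mid i h1 (by omega)
  have := l.antitone (i + 1) i' (by omega) (by omega)
  omega

theorem Strip.bottom_mem {l m : YPartition} {a b : ℕ} (h : Strip l m a b) :
    (b, m.part b + 1) ∈ stripCells l m := by
  rw [h.mem_iff]
  exact ⟨h.hab, le_rfl, by omega, h.last⟩

theorem Strip.top_mem {l m : YPartition} {a b : ℕ} (h : Strip l m a b) :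
    (a, l.part a) ∈ stripCells l m := by
  rw [h.mem_iff]
  exact ⟨le_rfl, h.hab, h.lt le_rfl h.hab, le_rfl⟩

theorem Strip.exists_content {l m : YPartition} {a b : ℕ} (h : Strip l m a b) (k : ℕ) :
    (m.part b : ℤ) - b < (l.part a : ℤ) - a - k →
    ∃ i j, (i, j) ∈ stripCells l m ∧ (j : ℤ) - i = (l.part a : ℤ) - a - k := by
  induction k with
  | zero => intro _; exact ⟨a, l.part a, h.top_mem, by simp⟩
  | succ k ih =>
    intro hk
    push_cast at hk
    obtain ⟨i, j, hm, he⟩ := ih (by omega)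
    obtain ⟨i', j', h1, h2, h3⟩ := h.step hm (by
      intro hc
      simp only [Prod.mk.injEq] at hc
      omega)
    exact ⟨i', j', h1, by push_cast; omega⟩

theorem Strip.ncard {l m : YPartition} {a b : ℕ} (h : Strip l m a b) :
    ((stripCells l m).ncard : ℤ) = (l.part a : ℤ) - a - ((m.part b : ℤ) - b) := by
  have himg : Set.image (fun p : ℕ × ℕ => (p.2 : ℤ) - p.1) (stripCells l m) =
      ((Finset.Ioc ((m.part b : ℤ) - b) ((l.part a : ℤ) - a) : Finset ℤ) : Set ℤ) := by
    ext z
    simp only [Set.mem_image, Prod.exists, Finset.coe_Ioc, Set.mem_Ioc]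
    constructor
    · rintro ⟨i, j, hp, rfl⟩
      exact h.content hp
    · rintro ⟨h1, h2⟩
      obtain ⟨i, j, hm, he⟩ := h.exists_content ((l.part a : ℤ) - a - z).toNat (by omega)
      exact ⟨i, j, hm, by omega⟩
  have hinj : Set.InjOn (fun p : ℕ × ℕ => (p.2 : ℤ) - p.1) (stripCells l m) := by
    rintro ⟨i, j⟩ hp ⟨i', j'⟩ hq he
    simp only at he
    have h1 := h.inj hp hq he
    have h2 := h.inj hq hp he.symm
    simp only [Prod.mk.injEq]
    omega
  rw [← hinj.ncard_image, himg, Set.ncard_coe_finset, Int.card_Ioc]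
  have := (h.content h.bottom_mem).2
  have := (h.content h.bottom_mem).1
  omega

theorem BoxAdjacent.symm' {p q : ℕ × ℕ} (h : YPartition.BoxAdjacent p q) :
    YPartition.BoxAdjacent q p := by
  unfold YPartition.BoxAdjacent at *
  omega

theorem Strip.connected {l m : YPartition} {a b : ℕ} (h : Strip l m a b) :
    YPartition.SetConnected (stripCells l m) := by
  have key : ∀ n : ℕ, ∀ i j, (i, j) ∈ stripCells l m → (j : ℤ) - i - ((m.part b : ℤ) - b) ≤ n →
      Relation.ReflTransGen (fun x y => x ∈ stripCells l m ∧ y ∈ stripCells l m ∧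
        YPartition.BoxAdjacent x y) (i, j) (b, m.part b + 1) := by
    intro n
    induction n with
    | zero =>
      intro i j hp hn
      have := (h.content hp).1
      simp at hn; omega
    | succ n ih =>
      intro i j hp hn
      by_cases hc : (i, j) = (b, m.part b + 1)
      · rw [hc]
      · obtain ⟨i', j', h1, h2, h3⟩ := h.step hp hc
        exact Relation.ReflTransGen.head ⟨hp, h1, h2⟩ (ih i' j' h1 (by push_cast at hn; omega))
  have key2 : ∀ p ∈ stripCells l m, Relation.ReflTransGen (fun x y => x ∈ stripCells l m ∧
      y ∈ stripCells l m ∧ YPartition.BoxAdjacent x y) p (b, m.part b + 1) := by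
    rintro ⟨i, j⟩ hp
    exact key _ i j hp (Int.self_le_toNat _)
  intro p hp q hq
  refine (key2 p hp).trans ?_
  have : Std.Symm (fun x y => x ∈ stripCells l m ∧
      y ∈ stripCells l m ∧ YPartition.BoxAdjacent x y) :=
    ⟨fun x y hxy => ⟨hxy.2.1, hxy.1, BoxAdjacent.symm' hxy.2.2⟩⟩
  exact Relation.ReflTransGen.stdSymm.symm _ _ (key2 q hq)

theorem Strip.removeHook {l m : YPartition} {a b n : ℕ} (h : Strip l m a b)
    (hn : (l.part a : ℤ) - a - ((m.part b : ℤ) - b) = n) : YPartition.RemoveHook n l m := by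
  have hsub : m.cells ⊆ l.cells := by
    rintro ⟨i, j⟩ ⟨h1, h2, h3⟩
    exact ⟨h1, h2, le_trans h3 (h.le i)⟩
  have hm : m.cells = l.cells \ stripCells l m := by
    unfold stripCells
    rw [Set.sdiff_sdiff_cancel_left hsub]
  refine ⟨stripCells l m, ⟨Set.sdiff_subset, ?_, h.connected, ?_, ⟨m, hm⟩⟩, hm⟩
  · have := h.ncard
    omega
  · rintro ⟨i, j, h1, h2, h3, h4⟩
    rw [h.mem_iff] at h1 h4
    have := h.mid i (by omega) (by omega)
    omega

theorem crossing {S : Set (ℕ × ℕ)} {p q : ℕ × ℕ} (i : ℕ)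
    (h : Relation.ReflTransGen (fun x y => x ∈ S ∧ y ∈ S ∧ YPartition.BoxAdjacent x y) p q)
    (hp : p.1 ≤ i) (hq : i < q.1) : ∃ j, (i, j) ∈ S ∧ (i + 1, j) ∈ S := by
  induction h with
  | refl => omega
  | @tail x y hxy hy ih =>
    by_cases hx : i < x.1
    · exact ih hx
    · obtain ⟨h1, h2, h3⟩ := hy
      obtain ⟨x1, x2⟩ := x
      obtain ⟨y1, y2⟩ := y
      unfold YPartition.BoxAdjacent at h3
      simp only at h3 hx hq
      obtain ⟨rfl, rfl, rfl⟩ : x1 = i ∧ y1 = i + 1 ∧ y2 = x2 := by omega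
      exact ⟨y2, h1, h2⟩

theorem removeHook_strip {l m : YPartition} {n : ℕ} (hn : 1 ≤ n)
    (h : YPartition.RemoveHook n l m) :
    ∃ a b, Strip l m a b ∧ (l.part a : ℤ) - a - ((m.part b : ℤ) - b) = n := by
  obtain ⟨S, ⟨hS, hcard, hconn, hsq, -⟩, hm⟩ := h
  have hSe : S = stripCells l m := by
    unfold stripCells
    rw [hm, Set.sdiff_sdiff_cancel_left hS]
  have hsub : m.cells ⊆ l.cells := by rw [hm]; exact Set.sdiff_subset
  have hle : ∀ i, m.part i ≤ l.part i := by
    intro i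
    rcases Nat.eq_zero_or_pos i with rfl | hi
    · rw [m.zero_at_zero]; omega
    · rcases Nat.eq_zero_or_pos (m.part i) with h0 | h0
      · omega
      · exact (hsub (show (i, m.part i) ∈ m.cells from ⟨hi, h0, le_rfl⟩)).2.2
  have hmem : ∀ i j, (i, j) ∈ S ↔ 1 ≤ i ∧ m.part i < j ∧ j ≤ l.part i := by
    intro i j
    rw [hSe]
    unfold stripCells YPartition.cells
    simp only [Set.mem_sdiff, Set.mem_ofPred_eq]
    constructor
    · rintro ⟨⟨h1, h2, h3⟩, h4⟩
      refine ⟨h1, ?_, h3⟩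
      by_contra hc
      exact h4 ⟨h1, h2, by omega⟩
    · rintro ⟨h1, h3, h4⟩
      exact ⟨⟨by omega, by omega, h4⟩, fun h5 => by omega⟩
  have hfin : S.Finite := (cells_finite l).subset hS
  have hne : S.Nonempty := by
    rw [← Set.ncard_pos hfin]; omega
  obtain ⟨⟨a, ja⟩, hpa, hmin⟩ := Set.exists_min_image S (fun p => p.1) hfin hne
  obtain ⟨⟨b, jb⟩, hpb, hmax⟩ := Set.exists_max_image S (fun p => p.1) hfin hne
  simp only at hmin hmax
  have ha := (hmem _ _).1 hpa
  have hb := (hmem _ _).1 hpb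
  have hstrip : Strip l m a b := by
    refine ⟨ha.1, hmin _ hpb, ?_, ?_, by omega⟩
    · intro i hi
      by_contra hc
      have h1 := hle i
      have hi0 : 1 ≤ i := by
        rcases Nat.eq_zero_or_pos i with rfl | h0
        · exact absurd (by rw [l.zero_at_zero, m.zero_at_zero]) hc
        · exact h0
      have h2 : (i, l.part i) ∈ S := (hmem _ _).2 ⟨hi0, by omega, le_rfl⟩
      have h3 := hmin _ h2
      have h4 := hmax _ h2
      simp only at h3 h4
      omega
    · intro i h1 h2
      obtain ⟨j, hj1, hj2⟩ := crossing i (hconn _ hpa _ hpb) h1 h2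
      rw [hmem] at hj1 hj2
      by_contra hc
      apply hsq
      have h3 := m.antitone i (i + 1) hj1.1 (by omega)
      have h4 := l.antitone i (i + 1) hj1.1 (by omega)
      refine ⟨i, l.part (i + 1) - 1, ?_, ?_, ?_, ?_⟩ <;> rw [hmem] <;> omega
  refine ⟨a, b, hstrip, ?_⟩
  rw [← hstrip.ncard, ← hSe, hcard]

theorem Strip.beads {l m : YPartition} {a b : ℕ} (h : Strip l m a b) (z : ℤ) :
    z ∈ beads m ↔ (z ∈ beads l ∧ z ≠ (l.part a : ℤ) - a) ∨ z = (m.part b : ℤ) - b := by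
  have ha := h.ha
  have hab := h.hab
  constructor
  · rintro ⟨i, hi, rfl⟩
    by_cases h1 : i < a ∨ b < i
    · left
      have := h.out i h1
      refine ⟨⟨i, hi, by omega⟩, fun hc => ?_⟩
      have := bead_inj l hi ha (by omega)
      omega
    · by_cases h2 : i = b
      · right; rw [h2]
      · left
        have h3 := h.mid i (by omega) (by omega)
        refine ⟨⟨i + 1, by omega, by push_cast; omega⟩, fun hc => ?_⟩
        have := bead_inj l (i := i + 1) (by omega) ha (by push_cast; omega)
        omega
  · rintro (⟨⟨i, hi, rfl⟩, h1⟩ | rfl)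
    · have hia : i ≠ a := by rintro rfl; exact h1 rfl
      by_cases h1 : i < a ∨ b < i
      · have := h.out i h1
        exact ⟨i, hi, by omega⟩
      · have h3 := h.mid (i - 1) (by omega) (by omega)
        rw [Nat.sub_add_cancel hi] at h3
        exact ⟨i - 1, by omega, by omega⟩
    · exact ⟨b, by omega, rfl⟩

theorem Strip.not_bead {l m : YPartition} {a b : ℕ} (h : Strip l m a b) :
    (m.part b : ℤ) - b ∉ _root_.beads l := by
  have ha := h.ha
  have hab := h.hab
  rintro ⟨i, hi, he⟩
  by_cases h1 : i ≤ b
  · have := bead_le l hi h1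
    have := h.last
    omega
  · have := h.out i (by omega)
    have := bead_strict m (i := b) (j := i) (by omega) (by omega)
    omega

/-- bead-set change under hook removal -/
def BeadMove (n : ℕ) (l m : YPartition) (x : ℤ) : Prop :=
  x ∈ beads l ∧ x - n ∉ beads l ∧ ∀ z, z ∈ beads m ↔ (z ∈ beads l ∧ z ≠ x) ∨ z = x - n

theorem removeHook_beads {l m : YPartition} {n : ℕ} (hn : 1 ≤ n)
    (h : YPartition.RemoveHook n l m) : ∃ x, BeadMove n l m x := by
  obtain ⟨a, b, hs, he⟩ := removeHook_strip hn h
  have h1 : (m.part b : ℤ) - b = (l.part a : ℤ) - a - n := by omega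
  refine ⟨(l.part a : ℤ) - a, ⟨a, hs.ha, rfl⟩, ?_, ?_⟩
  · rw [← h1]; exact hs.not_bead
  · rw [← h1]; exact hs.beads

theorem strip_move {l m : YPartition} {a b n : ℕ} (h : Strip l m a b)
    (hn : (l.part a : ℤ) - a - ((m.part b : ℤ) - b) = n) :
    YPartition.RemoveHook n l m ∧ BeadMove n l m ((l.part a : ℤ) - a) := by
  have h1 : (m.part b : ℤ) - b = (l.part a : ℤ) - a - n := by omega
  refine ⟨h.removeHook hn, ⟨a, h.ha, rfl⟩, ?_, ?_⟩
  · rw [← h1]; exact h.not_bead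
  · rw [← h1]; exact h.beads

theorem move_down (l : YPartition) {n : ℕ} (hn : 1 ≤ n) {x : ℤ} (hx : x ∈ beads l)
    (hx' : x - n ∉ beads l) : ∃ m, YPartition.RemoveHook n l m ∧ BeadMove n l m x := by
  obtain ⟨a, ha, rfl⟩ := hx
  obtain ⟨N, hN⟩ := l.eventually_zero
  have hex : ∃ k : ℕ, a ≤ k ∧ (l.part (k + 1) : ℤ) - (k + 1 : ℕ) < (l.part a : ℤ) - a - n := by
    refine ⟨N + a + n, by omega, ?_⟩
    rw [hN _ (by omega)]; omega
  classical
  obtain ⟨b, hab, hb1, hb2⟩ : ∃ b : ℕ, a ≤ b ∧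
      (l.part (b + 1) : ℤ) - (b + 1 : ℕ) < (l.part a : ℤ) - a - n ∧
      (l.part a : ℤ) - a - n < (l.part b : ℤ) - b := by
    refine ⟨Nat.find hex, (Nat.find_spec hex).1, (Nat.find_spec hex).2, ?_⟩
    rcases (Nat.find_spec hex).1.eq_or_lt with h1 | h1
    · rw [← h1]; omega
    · have h3 := Nat.find_min hex (m := Nat.find hex - 1) (by omega)
      rw [Nat.sub_add_cancel (by omega)] at h3
      have : (l.part a : ℤ) - a - n ≠ (l.part (Nat.find hex) : ℤ) - (Nat.find hex : ℕ) :=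
        fun h => hx' ⟨_, by omega, h⟩
      have h4 : ¬ ((l.part (Nat.find hex) : ℤ) - (Nat.find hex : ℕ) < (l.part a : ℤ) - a - n) :=
        fun h => h3 ⟨by omega, h⟩
      omega
  have hpos : ∀ i, 1 ≤ i → i ≤ b → 1 ≤ l.part i := by
    intro i h1 h2
    have := l.antitone i b h1 h2
    omega
  obtain ⟨m, hm⟩ := exists_part (fun i => if i < a then l.part i else if i < b then
      l.part (i + 1) - 1 else if i = b then ((l.part a : ℤ) - a - n + b).toNat else l.part i)
    (by simp [show 0 < a by omega, l.zero_at_zero])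
    (by
      intro i hi
      have h1 := l.antitone i (i + 1) hi (by omega)
      have h2 := l.antitone (i + 1) (i + 1 + 1) (by omega) (by omega)
      split_ifs with c1 c2 c3 c4 c5 c6 c7 c8 c9 c10 c11 c12 c13 <;> first | omega | skip
      all_goals
        first
        | (have : i + 1 = b := by omega
           subst this
           omega)
        | (have : i = b := by omega
           subst this
           omega))
    ⟨N + b + 1, fun i hi => by
      rw [if_neg (by omega), if_neg (by omega), if_neg (by omega), hN _ (by omega)]⟩
  have hmb : m.part b = ((l.part a : ℤ) - a - n + b).toNat := by
    rw [hm]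
    rw [if_neg (by omega), if_neg (by omega)]; simp only [if_true]
  refine ⟨m, strip_move (b := b) ⟨ha, hab, ?_, ?_, ?_⟩ ?_⟩
  · intro i hi
    rw [hm]
    split_ifs <;> first | rfl | omega
  · intro i h1 h2
    rw [hm]
    rw [if_neg (by omega), if_pos h2]
    have := hpos (i + 1) (by omega) (by omega)
    omega
  · omega
  · omega

theorem move_up (m : YPartition) {n : ℕ} (hn : 1 ≤ n) {x : ℤ} (hx : x ∈ beads m)
    (hx' : x + n ∉ beads m) : ∃ l, YPartition.RemoveHook n l m ∧ BeadMove n l m (x + n) := by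
  obtain ⟨c, hc, rfl⟩ := hx
  obtain ⟨N, hN⟩ := m.eventually_zero
  have hex : ∃ k : ℕ, 1 ≤ k ∧ (m.part k : ℤ) - k < (m.part c : ℤ) - c + n :=
    ⟨c, hc, by omega⟩
  classical
  obtain ⟨a, ha, hac, ha1, ha2⟩ : ∃ a : ℕ, 1 ≤ a ∧ a ≤ c ∧
      (m.part a : ℤ) - a < (m.part c : ℤ) - c + n ∧
      ∀ i, 1 ≤ i → i < a → (m.part c : ℤ) - c + n < (m.part i : ℤ) - i := by
    refine ⟨Nat.find hex, (Nat.find_spec hex).1, Nat.find_min' hex ⟨hc, by omega⟩,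
      (Nat.find_spec hex).2, ?_⟩
    intro i h1 h2
    have h3 := Nat.find_min hex h2
    have : (m.part c : ℤ) - c + n ≠ (m.part i : ℤ) - i := fun h => hx' ⟨_, h1, h⟩
    have h4 : ¬ ((m.part i : ℤ) - i < (m.part c : ℤ) - c + n) := fun h => h3 ⟨h1, h⟩
    omega
  obtain ⟨l, hl⟩ := exists_part (fun i => if i < a then m.part i else if i = a then
      ((m.part c : ℤ) - c + n + a).toNat else if i ≤ c then m.part (i - 1) + 1 else m.part i)
    (by simp [show 0 < a by omega, m.zero_at_zero])
    (by
      intro i hi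
      have h1 := m.antitone i (i + 1) hi (by omega)
      have h2 : 2 ≤ i → m.part i ≤ m.part (i - 1) :=
        fun h => m.antitone (i - 1) i (by omega) (by omega)
      have h3 := ha2 i hi
      simp only [Nat.add_sub_cancel]
      split_ifs with c1 c2 c3 c4 c5 c6 c7 c8 c9 c10 c11 c12 c13 <;> first | omega | skip
      all_goals
        have : i = a := by omega
        subst this
        omega)
    ⟨N + c + 1, fun i hi => by
      rw [if_neg (by omega), if_neg (by omega), if_neg (by omega), hN _ (by omega)]⟩
  have hla : l.part a = ((m.part c : ℤ) - c + n + a).toNat := by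
    rw [hl]
    rw [if_neg (by omega)]; simp only [if_true]
  have hla' : (l.part a : ℤ) - a = (m.part c : ℤ) - c + n := by omega
  have := strip_move (l := l) (m := m) (a := a) (b := c) (n := n) ⟨ha, hac, ?_, ?_, ?_⟩ (by omega)
  · rw [hla'] at this; exact ⟨l, this⟩
  · intro i hi
    rw [hl]
    split_ifs <;> first | rfl | omega
  · intro i h1 h2
    rw [hl]
    rw [if_neg (by omega), if_neg (by omega), if_pos (by omega), Nat.add_sub_cancel]
  · rcases hac.eq_or_lt with rfl | h1
    · omega
    · have : l.part c = m.part (c - 1) + 1 := by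
        rw [hl]
        rw [if_neg (by omega), if_neg (by omega), if_pos (by omega)]
      have := m.antitone (c - 1) c (by omega) (by omega)
      omega

theorem removeHook_size {l m : YPartition} {n : ℕ} (h : YPartition.RemoveHook n l m) :
    l.size = m.size + n := by
  obtain ⟨S, ⟨hS, hcard, -⟩, hm⟩ := h
  unfold YPartition.size
  rw [hm, ← hcard, Set.ncard_sdiff_add_ncard_of_subset hS (cells_finite l)]

theorem relIter_size {l m : YPartition} {n w : ℕ}
    (h : YPartition.RelIter (YPartition.RemoveHook n) w l m) : l.size = m.size + n * w := by
  induction w generalizing l with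
  | zero => simp only [YPartition.RelIter] at h; rw [h]; simp
  | succ w ih =>
    obtain ⟨c, h1, h2⟩ := h
    rw [removeHook_size h1, ih h2]; ring


theorem BeadMove.inv {n : ℕ} {l m : YPartition} {x : ℤ} (hn : 1 ≤ n) (h : BeadMove n l m x)
    (z : ℤ) : z ∈ beads l ↔ (z ∈ beads m ∧ z ≠ x - n) ∨ z = x := by
  obtain ⟨h1, h2, h3⟩ := h
  rw [h3]
  constructor
  · intro hz
    by_cases hx : z = x
    · right; exact hx
    · left
      refine ⟨Or.inl ⟨hz, hx⟩, ?_⟩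
      rintro rfl; exact h2 hz
  · rintro (⟨⟨h4, _⟩ | h4, h5⟩ | rfl)
    · exact h4
    · exact absurd h4 h5
    · exact h1

theorem BeadMove.low_mem {n : ℕ} {l m : YPartition} {x : ℤ} (h : BeadMove n l m x) :
    x - n ∈ beads m := (h.2.2 _).2 (Or.inr rfl)

theorem BeadMove.high_not_mem {n : ℕ} {l m : YPartition} {x : ℤ} (hn : 1 ≤ n)
    (h : BeadMove n l m x) : x ∉ beads m := by
  rw [h.2.2]
  rintro (⟨_, h1⟩ | h1)
  · exact h1 rfl
  · omega

theorem beads_empty (z : ℤ) : z ∈ beads YPartition.emptyP ↔ z < 0 := by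
  constructor
  · rintro ⟨i, hi, rfl⟩
    simp only [YPartition.emptyP]; push_cast; omega
  · intro h
    exact ⟨(-z).toNat, by omega, by simp only [YPartition.emptyP]; omega⟩

theorem first_bead (a : YPartition) : (a.part 1 : ℤ) - 1 ∈ beads a := ⟨1, le_rfl, by simp⟩

theorem le_first_bead (a : YPartition) {z : ℤ} (h : z ∈ beads a) : z ≤ (a.part 1 : ℤ) - 1 := by
  obtain ⟨i, hi, rfl⟩ := h
  have := bead_le a le_rfl hi
  simpa using this

theorem first_gap (a : YPartition) : -(a.length : ℤ) ∉ beads a := by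
  have := gapPos_not_bead a (b := 1) le_rfl
  unfold gapPos at this
  simpa [YPartition.length] using this

theorem first_gap_le (a : YPartition) {z : ℤ} (h : z ∉ beads a) : -(a.length : ℤ) ≤ z := by
  obtain ⟨b, hb, rfl⟩ := exists_gap a h
  have := gap_le a le_rfl hb
  unfold gapPos at *
  unfold YPartition.length
  omega

theorem eq_empty_of_part {a : YPartition} (h : a.part 1 = 0) : a = YPartition.emptyP := by
  apply YPartition.ext_part
  intro i hi
  have := a.antitone 1 i le_rfl hi
  simp only [YPartition.emptyP]; omega

theorem size_empty : YPartition.emptyP.size = 0 := by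
  have : YPartition.emptyP.cells = ∅ := by
    ext ⟨i, j⟩
    constructor
    · rintro ⟨h1, h2, h3⟩
      simp only [YPartition.emptyP] at h2 h3
      omega
    · exact fun h => h.elim
  unfold YPartition.size
  rw [this, Set.ncard_empty]

theorem length_pos {a : YPartition} (h : a ≠ YPartition.emptyP) : 1 ≤ a.length := by
  by_contra hc
  have := (length_le_iff a 0).1 (by omega)
  exact h (eq_empty_of_part this)

theorem part_pos {a : YPartition} (h : a ≠ YPartition.emptyP) : 1 ≤ a.part 1 := by
  by_contra hc
  exact h (eq_empty_of_part (by omega))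

theorem exists_down {a : YPartition} (h : a ≠ YPartition.emptyP) :
    ∃ m z, BeadMove 1 a m (z + 1) ∧ a.size = m.size + 1 := by
  have hl := length_pos h
  have h1 : 1 ≤ a.part a.length := by
    by_contra hc
    have := (length_le_iff a (a.length - 1)).2 (by rw [Nat.sub_add_cancel hl]; omega)
    omega
  have h2 : a.part (a.length + 1) = 0 := (length_le_iff a _).1 le_rfl
  have hx : (a.part a.length : ℤ) - a.length ∈ beads a := ⟨_, hl, rfl⟩
  have hx' : (a.part a.length : ℤ) - a.length - (1 : ℕ) ∉ beads a := by
    rintro ⟨i, hi, he⟩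
    rcases Nat.lt_or_ge a.length i with h3 | h3
    · have := bead_le a (i := a.length + 1) (by omega) h3
      push_cast at *; omega
    · have := bead_le a hi h3
      push_cast at *; omega
  obtain ⟨m, hm1, hm2⟩ := move_down a le_rfl hx hx'
  refine ⟨m, (a.part a.length : ℤ) - a.length - 1, ?_, removeHook_size hm1⟩
  rwa [sub_add_cancel]

def RunR (n : ℕ) (X : Set ℤ) (c : ℤ) (a : YPartition) : Prop :=
  ∀ z : ℤ, c + n * (z + 1) ∈ X ↔ z ∈ beads a

def RunC (n : ℕ) (X : Set ℤ) (d : ℤ) (b : YPartition) : Prop :=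
  ∀ z : ℤ, d - n * (z + 1) ∈ X ↔ z ∉ beads b

theorem runR_inj {n : ℕ} (hn : 1 ≤ n) {c z z' : ℤ} :
    c + n * (z + 1) = c + n * (z' + 1) ↔ z = z' := by
  have : (n : ℤ) ≠ 0 := by omega
  constructor
  · intro h
    have := mul_left_cancel₀ this (add_left_cancel h)
    omega
  · rintro rfl; rfl

theorem runC_inj {n : ℕ} (hn : 1 ≤ n) {c z z' : ℤ} :
    c - n * (z + 1) = c - n * (z' + 1) ↔ z = z' := by
  have : (n : ℤ) ≠ 0 := by omega
  constructor
  · intro h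
    have := mul_left_cancel₀ this (sub_right_injective h)
    omega
  · rintro rfl; rfl

/-- RunR compatible with simultaneous moves -/
theorem runR_move {n : ℕ} (hn : 1 ≤ n) {l m a a' : YPartition} {c z0 : ℤ}
    (h : RunR n (beads m) c a) (h1 : BeadMove n l m (c + n * (z0 + 1) + n))
    (h2 : BeadMove 1 a' a (z0 + 1)) : RunR n (beads l) c a' := by
  intro z
  rw [h1.inv hn, h2.inv le_rfl, h z]
  have e1 : c + n * (z0 + 1) + n - n = c + n * (z0 + 1) := by ring
  have e2 : c + n * (z0 + 1) + n = c + n * ((z0 + 1) + 1) := by ring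
  rw [e1, e2, ne_eq, runR_inj hn, runR_inj hn]
  simp

theorem runC_move {n : ℕ} (hn : 1 ≤ n) {l m b b' : YPartition} {d z0 : ℤ}
    (h : RunC n (beads m) d b) (h1 : BeadMove n l m (d - n * (z0 + 1)))
    (h2 : BeadMove 1 b' b (z0 + 1)) : RunC n (beads l) d b' := by
  intro z
  rw [h1.inv hn, h2.inv le_rfl, h z]
  have e1 : d - n * (z0 + 1) - n = d - n * ((z0 + 1) + 1) := by ring
  have h3 := h2.low_mem
  have h4 := h2.high_not_mem le_rfl
  rw [e1, ne_eq, runC_inj hn, runC_inj hn]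
  simp only [Nat.cast_one, add_sub_cancel_right] at h3 ⊢
  by_cases hz : z = z0 + 1
  · subst hz; simp
  · by_cases hz' : z = z0
    · subst hz'; simp
    · simp [hz, hz']

theorem runR_step {n : ℕ} (hn : 1 ≤ n) {l m a : YPartition} {c x : ℤ}
    (h : RunR n (beads m) c a) (hm : BeadMove n l m x) : ∃ a', RunR n (beads l) c a' := by
  by_cases hx : ∃ z0, x = c + n * (z0 + 1) + n
  · obtain ⟨z0, rfl⟩ := hx
    have h1 : z0 ∈ beads a := by
      rw [← h]
      have := hm.low_mem
      rwa [add_sub_cancel_right] at this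
    have h2 : z0 + (1 : ℕ) ∉ beads a := by
      rw [← h]
      have := hm.high_not_mem hn
      rwa [show c + n * (z0 + 1) + n = c + n * ((z0 + (1 : ℕ)) + 1) by push_cast; ring] at this
    obtain ⟨a', -, ha'⟩ := move_up a le_rfl h1 h2
    exact ⟨a', runR_move hn h hm ha'⟩
  · refine ⟨a, fun z => ?_⟩
    rw [hm.inv hn, ← h z]
    have h1 : c + n * (z + 1) ≠ x - n := fun h => hx ⟨z, by omega⟩
    have h2 : c + n * (z + 1) ≠ x := fun h => hx ⟨z - 1, by rw [← h]; ring⟩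
    simp [h1, h2]

theorem runC_step {n : ℕ} (hn : 1 ≤ n) {l m b : YPartition} {d x : ℤ}
    (h : RunC n (beads m) d b) (hm : BeadMove n l m x) : ∃ b', RunC n (beads l) d b' := by
  by_cases hx : ∃ z0, x = d - n * (z0 + 1)
  · obtain ⟨z0, rfl⟩ := hx
    have h1 : z0 ∈ beads b := by
      by_contra hc
      exact hm.high_not_mem hn ((h z0).2 hc)
    have h2 : z0 + (1 : ℕ) ∉ beads b := by
      rw [← h]
      have := hm.low_mem
      rwa [show d - n * (z0 + 1) - n = d - n * ((z0 + (1 : ℕ)) + 1) by push_cast; ring] at this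
    obtain ⟨b', -, hb'⟩ := move_up b le_rfl h1 h2
    exact ⟨b', runC_move hn h hm hb'⟩
  · refine ⟨b, fun z => ?_⟩
    rw [hm.inv hn, ← h z]
    have h1 : d - n * (z + 1) ≠ x - n := fun h => hx ⟨z - 1, by linarith⟩
    have h2 : d - n * (z + 1) ≠ x := fun h => hx ⟨z, h.symm⟩
    simp [h1, h2]

theorem runR_iter {n w : ℕ} (hn : 1 ≤ n) {l m a : YPartition} {c : ℤ}
    (h : RunR n (beads m) c a) (hm : YPartition.RelIter (YPartition.RemoveHook n) w l m) :
    ∃ a', RunR n (beads l) c a' := by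
  induction w generalizing l with
  | zero => simp only [YPartition.RelIter] at hm; rw [hm]; exact ⟨a, h⟩
  | succ w ih =>
    obtain ⟨k, h1, h2⟩ := hm
    obtain ⟨a1, ha1⟩ := ih h2
    obtain ⟨x, hx⟩ := removeHook_beads hn h1
    exact runR_step hn ha1 hx

theorem runC_iter {n w : ℕ} (hn : 1 ≤ n) {l m a : YPartition} {c : ℤ}
    (h : RunC n (beads m) c a) (hm : YPartition.RelIter (YPartition.RemoveHook n) w l m) :
    ∃ a', RunC n (beads l) c a' := by
  induction w generalizing l with
  | zero => simp only [YPartition.RelIter] at hm; rw [hm]; exact ⟨a, h⟩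
  | succ w ih =>
    obtain ⟨k, h1, h2⟩ := hm
    obtain ⟨a1, ha1⟩ := ih h2
    obtain ⟨x, hx⟩ := removeHook_beads hn h1
    exact runC_step hn ha1 hx

theorem bead_iter {n w : ℕ} (hn : 1 ≤ n) {l m : YPartition}
    (hm : YPartition.RelIter (YPartition.RemoveHook n) w l m) {p : ℤ} (hp : p ∈ beads m) :
    ∃ x ∈ beads l, p ≤ x ∧ (n : ℤ) ∣ x - p := by
  induction w generalizing l with
  | zero => simp only [YPartition.RelIter] at hm; rw [hm]; exact ⟨p, hp, le_rfl, by simp⟩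
  | succ w ih =>
    obtain ⟨k, h1, h2⟩ := hm
    obtain ⟨x, hx, hpx, hd⟩ := ih h2
    obtain ⟨y, hy⟩ := removeHook_beads hn h1
    by_cases hxy : x = y - n
    · refine ⟨y, hy.1, by omega, ?_⟩
      have : y - p = (x - p) + n := by omega
      rw [this]
      exact dvd_add hd dvd_rfl
    · exact ⟨x, (hy.inv hn x).2 (Or.inl ⟨hx, hxy⟩), hpx, hd⟩

theorem gap_iter {n w : ℕ} (hn : 1 ≤ n) {l m : YPartition}
    (hm : YPartition.RelIter (YPartition.RemoveHook n) w l m) {p : ℤ} (hp : p ∉ beads m) :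
    ∃ x, x ∉ beads l ∧ x ≤ p ∧ (n : ℤ) ∣ x - p := by
  induction w generalizing l with
  | zero => simp only [YPartition.RelIter] at hm; rw [hm]; exact ⟨p, hp, le_rfl, by simp⟩
  | succ w ih =>
    obtain ⟨k, h1, h2⟩ := hm
    obtain ⟨x, hx, hpx, hd⟩ := ih h2
    obtain ⟨y, hy⟩ := removeHook_beads hn h1
    by_cases hxy : x = y
    · refine ⟨y - n, hy.2.1, by omega, ?_⟩
      have : y - n - p = (x - p) - n := by omega
      rw [this]
      exact dvd_sub hd dvd_rfl
    · refine ⟨x, ?_, hpx, hd⟩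
      rw [hy.inv hn]
      rintro (⟨h3, _⟩ | h3)
      · exact hx h3
      · exact hxy h3

/-- Flush runner. -/
theorem flush_mul {n : ℕ} {N : Set ℤ} (hf : ∀ x ∈ N, x - n ∈ N) {x : ℤ} (hx : x ∈ N) (k : ℕ) :
    x - n * k ∈ N := by
  induction k with
  | zero => simpa using hx
  | succ k ih =>
    have := hf _ ih
    rwa [show x - n * ((k + 1 : ℕ) : ℤ) = x - n * k - n by push_cast; ring]

theorem flush_le {n : ℕ} (hn : 1 ≤ n) {N : Set ℤ} (hf : ∀ x ∈ N, x - n ∈ N) {x y : ℤ}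
    (hx : x ∈ N) (hyx : y ≤ x) (hd : (n : ℤ) ∣ x - y) : y ∈ N := by
  obtain ⟨k, hk⟩ := hd
  have hk0 : 0 ≤ k := by
    by_contra hc
    have : (n : ℤ) * k < 0 := mul_neg_of_pos_of_neg (by omega) (by omega)
    omega
  obtain ⟨k, rfl⟩ := Int.eq_ofNat_of_zero_le hk0
  have := flush_mul hf hx k
  rwa [show y = x - n * k by linarith]

theorem runR_flush {n : ℕ} (hn : 1 ≤ n) {N : Set ℤ} (hf : ∀ x ∈ N, x - n ∈ N) {c : ℤ}
    (hc : c ∈ N) (hc' : c + n ∉ N) : RunR n N c YPartition.emptyP := by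
  intro z
  rw [beads_empty]
  have hn' : (0 : ℤ) < n := by omega
  constructor
  · intro h
    by_contra hz
    apply hc'
    refine flush_le hn hf h ?_ ⟨z, by ring⟩
    have : (0 : ℤ) ≤ n * z := mul_nonneg hn'.le (by omega)
    linarith
  · intro h
    refine flush_le hn hf hc ?_ ⟨-(z + 1), by ring⟩
    have : (n : ℤ) * (z + 1) ≤ 0 := mul_nonpos_of_nonneg_of_nonpos hn'.le (by omega)
    linarith

theorem runC_flush {n : ℕ} (hn : 1 ≤ n) {N : Set ℤ} (hf : ∀ x ∈ N, x - n ∈ N) {d : ℤ}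
    (hd : d ∉ N) (hd' : d - n ∈ N) : RunC n N d YPartition.emptyP := by
  intro z
  rw [beads_empty]
  have hn' : (0 : ℤ) < n := by omega
  constructor
  · intro h hz
    apply hd
    refine flush_le hn hf h ?_ ⟨-(z + 1), by ring⟩
    have : (n : ℤ) * (z + 1) ≤ 0 := mul_nonpos_of_nonneg_of_nonpos hn'.le (by omega)
    linarith
  · intro h
    refine flush_le hn hf hd' ?_ ⟨z, by ring⟩
    have : (0 : ℤ) ≤ n * z := mul_nonneg hn'.le (by omega)
    linarith

/-- Data about the core. -/
structure CoreData (n : ℕ) (N : Set ℤ) (r s : ℕ) (c d e f : ℤ) : Prop where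
  flush : ∀ x ∈ N, x - n ∈ N
  c_mem : c ∈ N
  c_max : ∀ x ∈ N, x ≤ c
  e_mem : e ∈ N
  e_lo : c - n * r - n < e
  e_hi : e < c - n * r
  e_max : ∀ x ∈ N, ¬ (n : ℤ) ∣ x - c → x ≤ e
  d_mem : d ∉ N
  d_min : ∀ y, y ∉ N → d ≤ y
  f_mem : f ∉ N
  f_lo : d + n * s < f
  f_hi : f < d + n * s + n
  f_min : ∀ y, y ∉ N → ¬ (n : ℤ) ∣ y - d → f ≤ y
  box : d + n * s < c - n * r

theorem CoreData.d_lt_c {n : ℕ} {N : Set ℤ} {r s : ℕ} {c d e f : ℤ}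
    (h : CoreData n N r s c d e f) : d < c := by
  have := h.box
  have : (0 : ℤ) ≤ n * s := by positivity
  have : (0 : ℤ) ≤ n * r := by positivity
  omega

theorem CoreData.ncd {n : ℕ} (hn : 1 ≤ n) {N : Set ℤ} {r s : ℕ} {c d e f : ℤ}
    (h : CoreData n N r s c d e f) : ¬ (n : ℤ) ∣ c - d := by
  intro hd
  exact h.d_mem (flush_le hn h.flush h.c_mem h.d_lt_c.le hd)

theorem not_dvd_between {n : ℕ} (hn : 1 ≤ n) {x k : ℤ} (h1 : n * k < x) (h2 : x < n * k + n) :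
    ¬ (n : ℤ) ∣ x := by
  rintro ⟨j, rfl⟩
  have hn' : (0 : ℤ) < n := by omega
  have h3 : k < j := lt_of_mul_lt_mul_left h1 hn'.le
  have h4 : (n : ℤ) * j < n * (k + 1) := by linarith
  have h5 : j < k + 1 := lt_of_mul_lt_mul_left h4 hn'.le
  omega

theorem CoreData.nec {n : ℕ} (hn : 1 ≤ n) {N : Set ℤ} {r s : ℕ} {c d e f : ℤ}
    (h : CoreData n N r s c d e f) : ¬ (n : ℤ) ∣ e - c := by
  have h1 := h.e_lo
  have h2 := h.e_hi
  exact not_dvd_between hn (k := -(r : ℤ) - 1) (by linarith) (by linarith)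

theorem CoreData.nfd {n : ℕ} (hn : 1 ≤ n) {N : Set ℤ} {r s : ℕ} {c d e f : ℤ}
    (h : CoreData n N r s c d e f) : ¬ (n : ℤ) ∣ f - d := by
  have h1 := h.f_lo
  have h2 := h.f_hi
  exact not_dvd_between hn (k := (s : ℤ)) (by linarith) (by linarith)

/-- `l` is described by the pair `(a, b)`. -/
structure TT (n : ℕ) (N : Set ℤ) (c d : ℤ) (l a b : YPartition) : Prop where
  R : RunR n (beads l) c a
  C : RunC n (beads l) d b
  O : ∀ p : ℤ, ¬ (n : ℤ) ∣ p - c → ¬ (n : ℤ) ∣ p - d → (p ∈ beads l ↔ p ∈ N)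

theorem exists_R {n : ℕ} {c p : ℤ} (h : (n : ℤ) ∣ p - c) : ∃ z, p = c + n * (z + 1) := by
  obtain ⟨k, hk⟩ := h
  exact ⟨k - 1, by rw [sub_add_cancel]; linarith⟩

theorem exists_C {n : ℕ} {d p : ℤ} (h : (n : ℤ) ∣ p - d) : ∃ z, p = d - n * (z + 1) := by
  obtain ⟨k, hk⟩ := h
  exact ⟨-k - 1, by rw [sub_add_cancel]; linarith⟩

theorem TT.unique {n : ℕ} {N : Set ℤ} {c d : ℤ} {l l' a b : YPartition}
    (h : TT n N c d l a b) (h' : TT n N c d l' a b) : l = l' := by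
  apply beads_inj
  ext p
  by_cases h1 : (n : ℤ) ∣ p - c
  · obtain ⟨z, rfl⟩ := exists_R h1
    rw [h.R, h'.R]
  · by_cases h2 : (n : ℤ) ∣ p - d
    · obtain ⟨z, rfl⟩ := exists_C h2
      rw [h.C, h'.C]
    · rw [h.O p h1 h2, h'.O p h1 h2]

theorem TT.unique_pair {n : ℕ} {N : Set ℤ} {c d : ℤ} {l a b a' b' : YPartition}
    (h : TT n N c d l a b) (h' : TT n N c d l a' b') : a = a' ∧ b = b' := by
  constructor
  · apply beads_inj
    ext z
    rw [← h.R, h'.R]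
  · apply beads_inj
    ext z
    rw [← not_iff_not, ← h.C, h'.C]

theorem TT.moveR {n : ℕ} (hn : 1 ≤ n) {N : Set ℤ} {c d z0 : ℤ} (hcd : ¬ (n : ℤ) ∣ c - d)
    {l a b a' : YPartition} (h : TT n N c d l a b) (h2 : BeadMove 1 a' a (z0 + 1)) :
    ∃ l', TT n N c d l' a' b ∧ YPartition.RemoveHook n l' l := by
  have h3 := h2.low_mem
  have h4 := h2.high_not_mem le_rfl
  simp only [Nat.cast_one, add_sub_cancel_right] at h3
  have h5 : c + n * (z0 + 1) ∈ beads l := (h.R z0).2 h3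
  have h6 : c + n * (z0 + 1) + n ∉ beads l := by
    rw [show c + n * (z0 + 1) + n = c + n * ((z0 + 1) + 1) by ring, h.R]
    exact h4
  obtain ⟨l', hl1, hl2⟩ := move_up l hn h5 h6
  refine ⟨l', ⟨runR_move hn h.R hl2 h2, ?_, ?_⟩, hl1⟩
  · intro z
    rw [hl2.inv hn, ← h.C z]
    have h7 : d - n * (z + 1) ≠ c + n * (z0 + 1) + n - n :=
      fun he => hcd ⟨-(z + 1) - (z0 + 1), by linarith⟩
    have h8 : d - n * (z + 1) ≠ c + n * (z0 + 1) + n :=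
      fun he => hcd ⟨-(z + 1) - (z0 + 1) - 1, by linarith⟩
    simp only [h7, h8, ne_eq, not_false_eq_true, and_true, or_false]
  · intro p hp1 hp2
    rw [hl2.inv hn, ← h.O p hp1 hp2]
    have h7 : p ≠ c + n * (z0 + 1) + n - n :=
      fun he => hp1 ⟨z0 + 1, by linarith⟩
    have h8 : p ≠ c + n * (z0 + 1) + n :=
      fun he => hp1 ⟨z0 + 1 + 1, by linarith⟩
    simp only [h7, h8, ne_eq, not_false_eq_true, and_true, or_false]

theorem TT.moveC {n : ℕ} (hn : 1 ≤ n) {N : Set ℤ} {c d z0 : ℤ} (hcd : ¬ (n : ℤ) ∣ c - d)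
    {l a b b' : YPartition} (h : TT n N c d l a b) (h2 : BeadMove 1 b' b (z0 + 1)) :
    ∃ l', TT n N c d l' a b' ∧ YPartition.RemoveHook n l' l := by
  have h3 := h2.low_mem
  have h4 := h2.high_not_mem le_rfl
  simp only [Nat.cast_one, add_sub_cancel_right] at h3
  have h5 : d - n * ((z0 + 1) + 1) ∈ beads l := (h.C _).2 h4
  have h6 : d - n * ((z0 + 1) + 1) + n ∉ beads l := by
    rw [show d - n * ((z0 + 1) + 1) + n = d - n * (z0 + 1) by ring, h.C]
    exact fun hc => hc h3
  obtain ⟨l', hl1, hl2⟩ := move_up l hn h5 h6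
  rw [show d - n * ((z0 + 1) + 1) + n = d - n * (z0 + 1) by ring] at hl2
  refine ⟨l', ⟨?_, runC_move hn h.C hl2 h2, ?_⟩, hl1⟩
  · intro z
    rw [hl2.inv hn, ← h.R z]
    have h7 : c + n * (z + 1) ≠ d - n * (z0 + 1) - n :=
      fun he => hcd ⟨-(z + 1) - (z0 + 1) - 1, by linarith⟩
    have h8 : c + n * (z + 1) ≠ d - n * (z0 + 1) :=
      fun he => hcd ⟨-(z + 1) - (z0 + 1), by linarith⟩
    simp only [h7, h8, ne_eq, not_false_eq_true, and_true, or_false]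
  · intro p hp1 hp2
    rw [hl2.inv hn, ← h.O p hp1 hp2]
    have h7 : p ≠ d - n * (z0 + 1) - n :=
      fun he => hp2 ⟨-(z0 + 1) - 1, by linarith⟩
    have h8 : p ≠ d - n * (z0 + 1) :=
      fun he => hp2 ⟨-(z0 + 1), by linarith⟩
    simp only [h7, h8, ne_eq, not_false_eq_true, and_true, or_false]

theorem TT.exists {n : ℕ} (hn : 1 ≤ n) {nu : YPartition} {r s : ℕ} {c d e f : ℤ}
    (hD : CoreData n (beads nu) r s c d e f) (w : ℕ) : ∀ a b : YPartition, a.size + b.size = w →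
    ∃ l, TT n (beads nu) c d l a b ∧
      YPartition.RelIter (YPartition.RemoveHook n) w l nu := by
  have hcd := hD.ncd hn
  induction w with
  | zero =>
    intro a b hab
    have ha : a = YPartition.emptyP := by
      by_contra h
      obtain ⟨_, _, _, h1⟩ := exists_down h
      omega
    have hb : b = YPartition.emptyP := by
      by_contra h
      obtain ⟨_, _, _, h1⟩ := exists_down h
      omega
    subst ha; subst hb
    refine ⟨nu, ⟨runR_flush hn hD.flush hD.c_mem ?_, runC_flush hn hD.flush hD.d_mem ?_,
      fun p _ _ => Iff.rfl⟩, rfl⟩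
    · intro h
      have := hD.c_max _ h
      omega
    · by_contra h
      have := hD.d_min _ h
      omega
  | succ w ih =>
    intro a b hab
    by_cases ha : a = YPartition.emptyP
    · have hb : b ≠ YPartition.emptyP := by
        rintro rfl
        rw [ha, size_empty] at hab
        omega
      obtain ⟨b', z, h1, h2⟩ := exists_down hb
      obtain ⟨l, hl1, hl2⟩ := ih a b' (by omega)
      obtain ⟨l', hl'1, hl'2⟩ := hl1.moveC hn hcd h1
      exact ⟨l', hl'1, l, hl'2, hl2⟩
    · obtain ⟨a', z, h1, h2⟩ := exists_down ha
      obtain ⟨l, hl1, hl2⟩ := ih a' b (by omega)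
      obtain ⟨l', hl'1, hl'2⟩ := hl1.moveR hn hcd h1
      exact ⟨l', hl'1, l, hl'2, hl2⟩


theorem core_flush {n : ℕ} (hn : 1 ≤ n) {nu : YPartition} (h : YPartition.IsCore n nu) :
    ∀ x ∈ beads nu, x - n ∈ beads nu := by
  intro x hx
  by_contra hc
  obtain ⟨m, ⟨S, hS, _⟩, _⟩ := move_down nu hn hx hc
  exact h ⟨S, hS⟩

theorem coreData {n : ℕ} (hn : 2 < n) {nu : YPartition} {r s : ℕ}
    (hcore : YPartition.IsCore n nu)
    (hrows : ∀ k : ℕ, 1 ≤ k → k ≤ r → nu.part k = nu.part (k + 1) + (n - 1))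
    (hrow' : nu.part (r + 1) ≠ nu.part (r + 2) + (n - 1))
    (hcols : ∀ k : ℕ, 1 ≤ k → k ≤ s → nu.colLen k = nu.colLen (k + 1) + (n - 1))
    (hcol' : nu.colLen (s + 1) ≠ nu.colLen (s + 2) + (n - 1))
    (hgt : s < nu.part (r + 1)) :
    ∃ c d e f, CoreData n (beads nu) r s c d e f := by
  have hflush := core_flush (by omega) hcore
  have hx : ∀ k : ℕ, k ≤ r →
      (nu.part (k + 1) : ℤ) - (k + 1 : ℕ) = (nu.part 1 : ℤ) - (1 : ℕ) - n * k := by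
    intro k
    induction k with
    | zero => intro _; simp
    | succ k ih =>
      intro hk
      have h1 := ih (by omega)
      have h2 := hrows (k + 1) (by omega) hk
      have h3 : (n : ℤ) * ((k + 1 : ℕ) : ℤ) = n * k + n := by push_cast; ring
      rw [h3]
      push_cast at *
      have h4 : (nu.part (k + 1) : ℤ) = nu.part (k + 1 + 1) + n - 1 := by omega
      linarith
  have hy : ∀ k : ℕ, k ≤ s → gapPos nu (k + 1) = gapPos nu 1 + n * k := by
    intro k
    induction k with
    | zero => intro _; simp
    | succ k ih =>
      intro hk
      have h1 := ih (by omega)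
      have h2 := hcols (k + 1) (by omega) hk
      have h3 : (n : ℤ) * ((k + 1 : ℕ) : ℤ) = n * k + n := by push_cast; ring
      rw [h3]
      unfold gapPos at *
      push_cast at *
      have h4 : (nu.colLen (k + 1) : ℤ) = nu.colLen (k + 1 + 1) + n - 1 := by omega
      linarith
  have hxr := hx r le_rfl
  have hys := hy s le_rfl
  refine ⟨(nu.part 1 : ℤ) - (1 : ℕ), gapPos nu 1, (nu.part (r + 2) : ℤ) - (r + 2 : ℕ),
    gapPos nu (s + 2), hflush, ⟨1, le_rfl, rfl⟩, ?_, ⟨r + 2, by omega, rfl⟩, ?_, ?_, ?_,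
    gapPos_not_bead nu le_rfl, ?_, gapPos_not_bead nu (by omega), ?_, ?_, ?_, ?_⟩
  · rintro x ⟨i, hi, rfl⟩
    exact bead_le nu le_rfl hi
  · rw [← hxr]
    obtain ⟨k, hk, hke⟩ := hflush _ ⟨r + 1, by omega, rfl⟩
    have h1 : r + 1 < k := by
      rw [← bead_lt_iff nu (by omega) hk]; omega
    have h2 : k ≠ r + 2 := by
      rintro rfl
      push_cast at hke
      omega
    have := bead_strict nu (i := r + 2) (j := k) (by omega) (by omega)
    omega
  · rw [← hxr]
    exact bead_strict nu (by omega) (by omega)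
  · rintro x ⟨k, hk, rfl⟩ hnd
    apply bead_le nu (by omega)
    by_contra hc
    apply hnd
    obtain ⟨j, rfl⟩ : ∃ j, k = j + 1 := ⟨k - 1, by omega⟩
    rw [hx j (by omega)]
    exact ⟨-j, by ring⟩
  · intro y hy'
    obtain ⟨b, hb, rfl⟩ := exists_gap nu hy'
    exact gap_le nu le_rfl hb
  · rw [← hys]
    exact gap_strict nu (by omega) (by omega)
  · rw [← hys]
    have hg : gapPos nu (s + 1) + n ∉ beads nu := by
      intro h
      have := hflush _ h
      rw [add_sub_cancel_right] at this
      exact gapPos_not_bead nu (by omega) this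
    obtain ⟨k, hk, hke⟩ := exists_gap nu hg
    have h1 : s + 1 < k := by
      by_contra hc
      have := gap_le nu hk (not_lt.mp hc)
      omega
    have h2 : k ≠ s + 2 := by
      rintro rfl
      unfold gapPos at hke
      push_cast at hke
      omega
    have := gap_strict nu (i := s + 2) (j := k) (by omega) (by omega)
    omega
  · intro y hy' hnd
    obtain ⟨k, hk, rfl⟩ := exists_gap nu hy'
    apply gap_le nu (by omega)
    by_contra hc
    apply hnd
    obtain ⟨j, rfl⟩ : ∃ j, k = j + 1 := ⟨k - 1, by omega⟩
    rw [hy j (by omega)]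
    exact ⟨j, by ring⟩
  · rw [← hxr, ← hys]
    exact (gap_lt_iff nu (by omega) (by omega)).2 hgt

theorem TT.jm {n : ℕ} (hn : 1 ≤ n) {nu l a b : YPartition} {r s : ℕ} {c d e f : ℤ}
    (hD : CoreData n (beads nu) r s c d e f) (h : TT n (beads nu) c d l a b)
    (ha : a.length ≤ r + 1) (hb : b.length ≤ s + 1) : YPartition.IsJM n l := by
  have hn0 : (0 : ℤ) < n := by exact_mod_cast hn
  have hR : ∀ y, y ∉ beads l → (n : ℤ) ∣ y - c → c - n * r ≤ y := by
    intro y hy hd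
    obtain ⟨z, rfl⟩ := exists_R hd
    rw [h.R z] at hy
    have h1 := first_gap_le a hy
    have h2 : (0 : ℤ) ≤ z + 1 + r := by omega
    nlinarith [mul_nonneg hn0.le h2]
  have hC : ∀ x, x ∈ beads l → (n : ℤ) ∣ x - d → x ≤ d + n * s := by
    intro x hx hd
    obtain ⟨z, rfl⟩ := exists_C hd
    rw [h.C z] at hx
    have h1 := first_gap_le b hx
    have h2 : (0 : ℤ) ≤ z + 1 + s := by omega
    nlinarith [mul_nonneg hn0.le h2]
  have hbox := hD.box
  rw [isJM_iff]
  intro x hx y hy hyx hdv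
  by_cases hxc : (n : ℤ) ∣ x - c
  · right
    have hyc : (n : ℤ) ∣ y - c := by
      have := dvd_sub hxc hdv
      rwa [show x - c - (x - y) = y - c by ring] at this
    have hy1 := hR y hy hyc
    intro x' hx' hyx'
    by_cases hx'c : (n : ℤ) ∣ x' - c
    · have := dvd_sub hx'c hyc
      rwa [show x' - c - (y - c) = x' - y by ring] at this
    exfalso
    by_cases hx'd : (n : ℤ) ∣ x' - d
    · have := hC x' hx' hx'd
      linarith
    · have h1 := hD.e_max x' ((h.O x' hx'c hx'd).1 hx') hx'c
      have h2 := hD.e_hi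
      linarith
  by_cases hxd : (n : ℤ) ∣ x - d
  · left
    have hx1 := hC x hx hxd
    intro y' hy' hyx'
    by_cases hy'd : (n : ℤ) ∣ y' - d
    · have := dvd_sub hxd hy'd
      rwa [show x - d - (y' - d) = x - y' by ring] at this
    exfalso
    by_cases hy'c : (n : ℤ) ∣ y' - c
    · have := hR y' hy' hy'c
      linarith
    · have h1 := hD.f_min y' (fun hh => hy' ((h.O y' hy'c hy'd).2 hh)) hy'd
      have h2 := hD.f_lo
      linarith
  exfalso
  apply hy
  have hyc : ¬ (n : ℤ) ∣ y - c := by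
    intro hh
    have := dvd_add hdv hh
    rw [show x - y + (y - c) = x - c by ring] at this
    exact hxc this
  have hyd : ¬ (n : ℤ) ∣ y - d := by
    intro hh
    have := dvd_add hdv hh
    rw [show x - y + (y - d) = x - d by ring] at this
    exact hxd this
  rw [h.O y hyc hyd]
  exact flush_le hn hD.flush ((h.O x hxc hxd).1 hx) hyx.le hdv

/-- combining a JM pair with a bead above and a gap below, both off the runner -/
theorem jm_contra {n : ℕ} {l : YPartition} (hJ : YPartition.IsJM n l) {x y u v : ℤ}
    (hx : x ∈ beads l) (hy : y ∉ beads l) (hyx : y < x) (hd : (n : ℤ) ∣ x - y)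
    (hu : u ∈ beads l) (hu1 : y < u) (hu2 : ¬ (n : ℤ) ∣ u - y)
    (hv : v ∉ beads l) (hv1 : v < x) (hv2 : ¬ (n : ℤ) ∣ x - v) : False := by
  rcases (isJM_iff n l).1 hJ x hx y hy hyx hd with h | h
  · exact hv2 (h v hv hv1)
  · exact hu2 (h u hu hu1)

theorem ndvd_trans {n u p y : ℤ} (h1 : n ∣ u - p) (h2 : ¬ n ∣ p - y) : ¬ n ∣ u - y := by
  intro h
  apply h2
  have := dvd_sub h h1
  rwa [show u - y - (u - p) = p - y by ring] at this

theorem ndvd_trans2 {n x q v : ℤ} (h1 : n ∣ v - q) (h2 : ¬ n ∣ x - q) : ¬ n ∣ x - v := by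
  intro h
  apply h2
  have := dvd_add h h1
  rwa [show x - v + (v - q) = x - q by ring] at this

/-- version with witnesses taken from the core -/
theorem jm_contra_core {n w : ℕ} (hn : 1 ≤ n) {l nu : YPartition} (hJ : YPartition.IsJM n l)
    (hm : YPartition.RelIter (YPartition.RemoveHook n) w l nu) {x y p q : ℤ}
    (hx : x ∈ beads l) (hy : y ∉ beads l) (hyx : y < x) (hd : (n : ℤ) ∣ x - y)
    (hp : p ∈ beads nu) (hp1 : y ≤ p) (hp2 : ¬ (n : ℤ) ∣ p - y)
    (hq : q ∉ beads nu) (hq1 : q ≤ x) (hq2 : ¬ (n : ℤ) ∣ x - q) : False := by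
  obtain ⟨u, hu, hu1, hu2⟩ := bead_iter hn hm hp
  obtain ⟨v, hv, hv1, hv2⟩ := gap_iter hn hm hq
  have h1 := ndvd_trans hu2 hp2
  have h2 := ndvd_trans2 hv2 hq2
  have h3 : u ≠ y := by rintro rfl; simp at h1
  have h4 : v ≠ x := by rintro rfl; simp at h2
  exact jm_contra hJ hx hy hyx hd hu (by omega) h1 hv (by omega) h2

theorem runR_extreme {n : ℕ} (hn : 1 ≤ n) {X : Set ℤ} {c : ℤ} {a : YPartition}
    (h : RunR n X c a) (ha : a ≠ YPartition.emptyP) :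
    (c + n * a.part 1 ∈ X) ∧ (c - n * a.length + n ∉ X) ∧
      c - n * a.length + n < c + n * a.part 1 := by
  have h1 := (h _).2 (first_bead a)
  have h2 := fun hh => first_gap a ((h (-(a.length : ℤ))).1 hh)
  rw [show c + (n : ℤ) * ((a.part 1 : ℤ) - 1 + 1) = c + n * a.part 1 by ring] at h1
  rw [show c + (n : ℤ) * (-(a.length : ℤ) + 1) = c - n * a.length + n by ring] at h2
  refine ⟨h1, h2, ?_⟩
  have h3 : (1 : ℤ) ≤ a.length := by exact_mod_cast length_pos ha
  have h4 : (1 : ℤ) ≤ a.part 1 := by exact_mod_cast part_pos ha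
  have hn0 : (0 : ℤ) < n := by exact_mod_cast hn
  nlinarith

theorem runC_extreme {n : ℕ} (hn : 1 ≤ n) {X : Set ℤ} {d : ℤ} {b : YPartition}
    (h : RunC n X d b) (ha : b ≠ YPartition.emptyP) :
    (d - n * b.part 1 ∉ X) ∧ (d + n * b.length - n ∈ X) ∧
      d - n * b.part 1 < d + n * b.length - n := by
  have h1 := fun hh => (h _).1 hh (first_bead b)
  have h2 := (h (-(b.length : ℤ))).2 (first_gap b)
  rw [show d - (n : ℤ) * ((b.part 1 : ℤ) - 1 + 1) = d - n * b.part 1 by ring] at h1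
  rw [show d - (n : ℤ) * (-(b.length : ℤ) + 1) = d + n * b.length - n by ring] at h2
  refine ⟨h1, h2, ?_⟩
  have h3 : (1 : ℤ) ≤ b.length := by exact_mod_cast length_pos ha
  have h4 : (1 : ℤ) ≤ b.part 1 := by exact_mod_cast part_pos ha
  have hn0 : (0 : ℤ) < n := by exact_mod_cast hn
  nlinarith

theorem nonempty_of_length {a : YPartition} {k : ℕ} (h : k < a.length) :
    a ≠ YPartition.emptyP := by
  rintro rfl
  have := (length_le_iff YPartition.emptyP 0).2 rfl
  omega

theorem jm_TT {n w : ℕ} (hn : 1 ≤ n) {nu l : YPartition} {r s : ℕ} {c d e f : ℤ}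
    (hD : CoreData n (beads nu) r s c d e f) (hJ : YPartition.IsJM n l)
    (hm : YPartition.RelIter (YPartition.RemoveHook n) w l nu) :
    ∃ a b, TT n (beads nu) c d l a b ∧ a.length ≤ r + 1 ∧ b.length ≤ s + 1 ∧
      a.size + b.size = w := by
  have hn0 : (0 : ℤ) < n := by exact_mod_cast hn
  have hcn : c + n ∉ beads nu := fun h => by have := hD.c_max _ h; omega
  have hdn : d - n ∈ beads nu := by
    by_contra h
    have := hD.d_min _ h
    omega
  have hdc := hD.d_lt_c
  have hncd := hD.ncd hn
  have hnec := hD.nec hn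
  have hnfd := hD.nfd hn
  obtain ⟨a, ha⟩ := runR_iter hn (runR_flush hn hD.flush hD.c_mem hcn) hm
  obtain ⟨b, hb⟩ := runC_iter hn (runC_flush hn hD.flush hD.d_mem hdn) hm
  have hO : ∀ p : ℤ, ¬ (n : ℤ) ∣ p - c → ¬ (n : ℤ) ∣ p - d → (p ∈ beads l ↔ p ∈ beads nu) := by
    intro p hpc hpd
    obtain ⟨c0, ⟨hc0, hc0p⟩, hmax⟩ :=
      Int.exists_greatest_of_bdd (P := fun x => x ∈ beads nu ∧ (n : ℤ) ∣ x - p)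
        ⟨c, fun z hz => hD.c_max z hz.1⟩ (by
          obtain ⟨k, hk⟩ : ∃ k : ℕ, p - n * k < d := by
            refine ⟨(p - d).toNat + 1, ?_⟩
            push_cast
            nlinarith [Int.self_le_toNat (p - d), Int.natCast_nonneg (p - d).toNat]
          refine ⟨p - n * k, ?_, ⟨-k, by ring⟩⟩
          by_contra hh
          have := hD.d_min _ hh
          omega)
    have hc0n : c0 + n ∉ beads nu := by
      intro hh
      have hdv : (n : ℤ) ∣ c0 + n - p := by
        have := dvd_add hc0p (dvd_refl (n : ℤ))
        rwa [show c0 - p + n = c0 + n - p by ring] at this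
      have := hmax _ ⟨hh, hdv⟩
      omega
    have hrun := runR_flush hn hD.flush hc0 hc0n
    obtain ⟨al, hal⟩ := runR_iter hn hrun hm
    by_cases hae : al = YPartition.emptyP
    · subst hae
      obtain ⟨z, rfl⟩ := exists_R (n := n) (c := c0) (p := p) (by
        rw [← dvd_neg]; rwa [show -(p - c0) = c0 - p by ring])
      rw [hal z, hrun z]
    · exfalso
      obtain ⟨h1, h2, h3⟩ := runR_extreme hn hal hae
      have h4 : (1 : ℤ) ≤ al.length := by exact_mod_cast length_pos hae
      have h5 : (1 : ℤ) ≤ al.part 1 := by exact_mod_cast part_pos hae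
      have h6 := hD.c_max _ hc0
      have h7 := hD.d_min _ hc0n
      refine jm_contra_core hn hJ hm h1 h2 h3 ⟨al.part 1 + al.length - 1, by ring⟩ hD.c_mem
        (by nlinarith) ?_ hD.d_mem (by nlinarith) ?_
      · intro hh
        apply hpc
        obtain ⟨i, hi⟩ := hh
        obtain ⟨j, hj⟩ := hc0p
        exact ⟨-i - j + al.length - 1, by linarith [hi, hj, mul_add (n : ℤ) (-i - j) (al.length - 1), mul_sub (n : ℤ) (-i) j, mul_sub (n : ℤ) al.length 1, mul_neg (n : ℤ) i, show (n : ℤ) * (-i - j + al.length - 1) = - (n * i) - n * j + n * al.length - n by ring]⟩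
      · intro hh
        apply hpd
        obtain ⟨i, hi⟩ := hh
        obtain ⟨j, hj⟩ := hc0p
        exact ⟨i - j - al.part 1, by linarith [show (n : ℤ) * (i - j - al.part 1) = n * i - n * j - n * al.part 1 by ring]⟩
  have hTT : TT n (beads nu) c d l a b := ⟨ha, hb, hO⟩
  refine ⟨a, b, hTT, ?_, ?_, ?_⟩
  · by_contra hc
    have hae : a ≠ YPartition.emptyP := nonempty_of_length (not_le.mp hc)
    obtain ⟨h1, h2, h3⟩ := runR_extreme hn ha hae
    have h4 : (r : ℤ) + 2 ≤ a.length := by exact_mod_cast (by omega : r + 2 ≤ a.length)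
    have h5 : (1 : ℤ) ≤ a.part 1 := by exact_mod_cast part_pos hae
    refine jm_contra_core hn hJ hm h1 h2 h3 ⟨a.part 1 + a.length - 1, by ring⟩ hD.e_mem
      (by nlinarith [hD.e_lo]) ?_ hD.d_mem (by nlinarith) ?_
    · rintro ⟨i, hi⟩
      exact hnec ⟨i - a.length + 1, by linarith [show (n : ℤ) * (i - a.length + 1) = n * i - n * a.length + n by ring]⟩
    · rintro ⟨i, hi⟩
      exact hncd ⟨i - a.part 1, by linarith [show (n : ℤ) * (i - a.part 1) = n * i - n * a.part 1 by ring]⟩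
  · by_contra hc
    have hae : b ≠ YPartition.emptyP := nonempty_of_length (not_le.mp hc)
    obtain ⟨h1, h2, h3⟩ := runC_extreme hn hb hae
    have h4 : (s : ℤ) + 2 ≤ b.length := by exact_mod_cast (by omega : s + 2 ≤ b.length)
    have h5 : (1 : ℤ) ≤ b.part 1 := by exact_mod_cast part_pos hae
    refine jm_contra_core hn hJ hm h2 h1 h3 ⟨b.part 1 + b.length - 1, by ring⟩ hD.c_mem
      (by nlinarith) ?_ hD.f_mem (by nlinarith [hD.f_hi]) ?_
    · rintro ⟨i, hi⟩
      exact hncd ⟨i - b.part 1, by linarith [show (n : ℤ) * (i - b.part 1) = n * i - n * b.part 1 by ring]⟩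
    · rintro ⟨i, hi⟩
      exact hnfd ⟨- i + b.length - 1, by linarith [show (n : ℤ) * (- i + b.length - 1) = - (n * i) + n * b.length - n by ring]⟩
  · obtain ⟨l', hl', hm'⟩ := TT.exists hn hD _ a b rfl
    have he : l' = l := TT.unique hl' hTT
    subst he
    have h1 := relIter_size hm
    have h2 := relIter_size hm'
    have h3 : n * w = n * (a.size + b.size) := by omega
    exact (Nat.eq_of_mul_eq_mul_left (by omega) h3).symm

/-- counting `(ℓ,0)`-JM partitions with a fixed core `ν` (whose first `r` row
differences and first `s` column differences equal `ℓ−1`, with `ν_{r+1} > s`) and fixed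
weight `w`: they are in bijection with pairs of partitions `(α,β)` with `len α ≤ r+1`,
`len β ≤ s+1`, `|α|+|β| = w`. -/
theorem statement4 (ℓ : ℕ) (hℓ : 2 < ℓ) (nu : YPartition) (r s : ℕ)
    (hcore : IsCore ℓ nu)
    (hrows : ∀ k : ℕ, 1 ≤ k → k ≤ r → nu.part k = nu.part (k + 1) + (ℓ - 1))
    (hrow' : nu.part (r + 1) ≠ nu.part (r + 2) + (ℓ - 1))
    (hcols : ∀ k : ℕ, 1 ≤ k → k ≤ s → nu.colLen k = nu.colLen (k + 1) + (ℓ - 1))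
    (hcol' : nu.colLen (s + 1) ≠ nu.colLen (s + 2) + (ℓ - 1))
    (hgt : s < nu.part (r + 1)) (w : ℕ) :
    Nat.card {lam : YPartition // IsJM ℓ lam ∧ HasCoreAndWeight ℓ lam nu w} =
      Nat.card {p : YPartition × YPartition //
        p.1.length ≤ r + 1 ∧ p.2.length ≤ s + 1 ∧ p.1.size + p.2.size = w} := by
  have hn : 1 ≤ ℓ := by omega
  obtain ⟨c, d, e, f, hD⟩ := coreData hℓ hcore hrows hrow' hcols hcol' hgt
  symm
  choose F hF1 hF2 using fun p : {p : YPartition × YPartition //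
        p.1.length ≤ r + 1 ∧ p.2.length ≤ s + 1 ∧ p.1.size + p.2.size = w} =>
    TT.exists hn hD w p.1.1 p.1.2 p.2.2.2
  refine Nat.card_congr (Equiv.ofBijective
    (fun p => ⟨F p, (hF1 p).jm hn hD p.2.1 p.2.2.1, hcore, hF2 p⟩) ⟨?_, ?_⟩)
  · intro p q hpq
    have h1 : F p = F q := congrArg Subtype.val hpq
    have h2 := hF1 p
    rw [h1] at h2
    obtain ⟨h3, h4⟩ := TT.unique_pair h2 (hF1 q)
    exact Subtype.ext (Prod.ext h3 h4)
  · rintro ⟨l, hJ, _, hm⟩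
    obtain ⟨a, b, hT, h1, h2, h3⟩ := jm_TT hn hD hJ hm
    exact ⟨⟨(a, b), h1, h2, h3⟩, Subtype.ext (TT.unique (hF1 ⟨(a, b), h1, h2, h3⟩) hT)⟩
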